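/- arXiv:1709.00059 — 2 statements merged into one kernel-verified Lean document; each statement's English description precedes it below -/
import Mathlib

section
/- Let k > 1 and let M ⊆ ℂ^{3k-1} be a 2k-dimensional smooth compact connected submanifold that is totally real except on a finite set S of generic CR-singularities. If M is polynomially convex, then there exists a smooth nonnegative function ρ : ℂ^{3k-1} → ℝ such that M = ρ^{-1}(0), ρ is plurisubharmonic on ℂ^{3k-1}, and ρ is strictly plurisubharmonic on ℂ^{3k-1} \ S. -/
open scoped Manifold ComplexConjugate

noncomputable section

/-- Evaluation of a holomorphic polynomial on `ℂ^n`. -/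
def evalPoly {n : ℕ} (P : MvPolynomial (Fin n) ℂ) (z : EuclideanSpace ℂ (Fin n)) : ℂ :=
  MvPolynomial.eval (fun i => z i) P

/-- The polynomially convex hull of a set `K ⊆ ℂ^n`. -/
def polyHull {n : ℕ} (K : Set (EuclideanSpace ℂ (Fin n))) : Set (EuclideanSpace ℂ (Fin n)) :=
  {z | ∀ P : MvPolynomial (Fin n) ℂ, ‖evalPoly P z‖ ≤ ⨆ w ∈ K, ‖evalPoly P w‖}

/-- A set is polynomially convex if it coincides with its polynomially convex hull. -/
def IsPolyConvex {n : ℕ} (K : Set (EuclideanSpace ℂ (Fin n))) : Prop := polyHull K = K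

/-- The rationally convex hull of a set `K ⊆ ℂ^n`. -/
def ratHull {n : ℕ} (K : Set (EuclideanSpace ℂ (Fin n))) : Set (EuclideanSpace ℂ (Fin n)) :=
  {z | ∀ P : MvPolynomial (Fin n) ℂ, evalPoly P z = 0 → ∃ w ∈ K, evalPoly P w = 0}

/-- The closed half-space `{x ∈ ℝ^d : x₀ ≥ 0}`. -/
def halfSpace (d : ℕ) (hd : 0 < d) : Set (EuclideanSpace ℝ (Fin d)) :=
  {x | 0 ≤ x ⟨0, hd⟩}

/-- `M ⊆ ℂ^n` is a `d`-dimensional smooth compact submanifold (possibly with boundary):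
every point admits a smooth local parametrization by a relatively open subset of the closed
half-space `H ⊆ ℝ^d`, which is an immersion and a homeomorphism onto a relatively open
subset of `M`. (Charts with image in the open half-space cover interior points, so closed
submanifolds are included.) -/
def IsSubmanifold {n : ℕ} (d : ℕ) (hd : 0 < d) (M : Set (EuclideanSpace ℂ (Fin n))) : Prop :=
  ∀ p ∈ M, ∃ (V : Set (EuclideanSpace ℝ (Fin d))) (U : Set (EuclideanSpace ℂ (Fin n)))
    (f : EuclideanSpace ℝ (Fin d) → EuclideanSpace ℂ (Fin n)),
    IsOpen V ∧ IsOpen U ∧ p ∈ U ∧ ContDiffOn ℝ (⊤ : ℕ∞) f V ∧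
    Set.InjOn f (V ∩ halfSpace d hd) ∧
    (∀ x ∈ V, Function.Injective (fderiv ℝ f x)) ∧
    f '' (V ∩ halfSpace d hd) = M ∩ U ∧
    (∀ W, IsOpen W → W ⊆ V → ∃ U', IsOpen U' ∧ f '' (W ∩ halfSpace d hd) = M ∩ U')

/-- `p` is a boundary point of the submanifold `M`: some local parametrization as above
maps a point on the boundary of the half-space to `p`. -/
def IsBoundaryPoint {n : ℕ} (d : ℕ) (hd : 0 < d) (M : Set (EuclideanSpace ℂ (Fin n)))
    (p : EuclideanSpace ℂ (Fin n)) : Prop :=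
  p ∈ M ∧ ∃ (V : Set (EuclideanSpace ℝ (Fin d))) (U : Set (EuclideanSpace ℂ (Fin n)))
    (f : EuclideanSpace ℝ (Fin d) → EuclideanSpace ℂ (Fin n)),
    IsOpen V ∧ IsOpen U ∧ p ∈ U ∧ ContDiffOn ℝ (⊤ : ℕ∞) f V ∧
    Set.InjOn f (V ∩ halfSpace d hd) ∧
    (∀ x ∈ V, Function.Injective (fderiv ℝ f x)) ∧
    f '' (V ∩ halfSpace d hd) = M ∩ U ∧
    (∀ W, IsOpen W → W ⊆ V → ∃ U', IsOpen U' ∧ f '' (W ∩ halfSpace d hd) = M ∩ U') ∧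
    ∃ x ∈ V ∩ halfSpace d hd, f x = p ∧ x ⟨0, hd⟩ = 0

/-- The tangent space of `M ⊆ ℂ^n` at `p`, as a real subspace of `ℂ^n`. -/
def tangentSpaceAt {n : ℕ} (M : Set (EuclideanSpace ℂ (Fin n)))
    (p : EuclideanSpace ℂ (Fin n)) : Submodule ℝ (EuclideanSpace ℂ (Fin n)) :=
  Submodule.span ℝ (tangentConeAt ℝ M p)

/-- `M` is totally real at `p`: `T_pM ∩ i·T_pM = {0}`. -/
def TotallyRealAt {n : ℕ} (M : Set (EuclideanSpace ℂ (Fin n)))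
    (p : EuclideanSpace ℂ (Fin n)) : Prop :=
  ∀ v ∈ tangentSpaceAt M p, Complex.I • v ∈ tangentSpaceAt M p → v = (0 : EuclideanSpace ℂ (Fin n))

/-- The Beloshapka–Coffman normal form `𝓜_k ⊆ ℂ^{3k-1}`, in coordinates
`Z = (z, w₁, …, w_{2k-2}, ζ₁, …, ζ_k)`, `w_τ = u_τ + i v_τ`. -/
def bcForm (k : ℕ) (hk : 1 < k) : Set (EuclideanSpace ℂ (Fin (3*k-1))) :=
  {Z | (∀ τ : ℕ, ∀ _h1 : 1 ≤ τ, ∀ _h2 : τ ≤ 2*k-2, (Z ⟨τ, by omega⟩).im = 0) ∧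
    Z ⟨2*k-1, by omega⟩ = (Complex.normSq (Z ⟨0, by omega⟩) : ℂ) +
      conj (Z ⟨0, by omega⟩) * (((Z ⟨1, by omega⟩).re : ℂ) + Complex.I * ((Z ⟨2, by omega⟩).re : ℂ)) ∧
    (∀ σ : ℕ, ∀ _h1 : 2 ≤ σ, ∀ _h2 : σ ≤ k-1,
      Z ⟨2*k-2+σ, by omega⟩ = conj (Z ⟨0, by omega⟩) *
        (((Z ⟨2*σ-1, by omega⟩).re : ℂ) + Complex.I * ((Z ⟨2*σ, by omega⟩).re : ℂ))) ∧
    Z ⟨3*k-2, by omega⟩ = (conj (Z ⟨0, by omega⟩))^2}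

/-- `p` is a generic CR-singularity of `M ⊆ ℂ^{3k-1}`: `(M, p)` is locally biholomorphic
to `(𝓜_k, O)`. -/
def IsGenericCRSingularity (k : ℕ) (hk : 1 < k) (M : Set (EuclideanSpace ℂ (Fin (3*k-1))))
    (p : EuclideanSpace ℂ (Fin (3*k-1))) : Prop :=
  ∃ (U V : Set (EuclideanSpace ℂ (Fin (3*k-1))))
    (Φ Ψ : EuclideanSpace ℂ (Fin (3*k-1)) → EuclideanSpace ℂ (Fin (3*k-1))),
    IsOpen U ∧ IsOpen V ∧ p ∈ U ∧ (0 : EuclideanSpace ℂ (Fin (3*k-1))) ∈ V ∧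
    DifferentiableOn ℂ Φ U ∧ DifferentiableOn ℂ Ψ V ∧
    Set.MapsTo Φ U V ∧ Set.MapsTo Ψ V U ∧
    (∀ x ∈ U, Ψ (Φ x) = x) ∧ (∀ y ∈ V, Φ (Ψ y) = y) ∧
    Φ p = 0 ∧ Φ '' (M ∩ U) = bcForm k hk ∩ V

/-- The Laplacian at `0` of the slice function `λ ↦ ρ(p + λ·v)`. -/
def sliceLaplacian {n : ℕ} (ρ : EuclideanSpace ℂ (Fin n) → ℝ)
    (p v : EuclideanSpace ℂ (Fin n)) : ℝ :=
  iteratedFDeriv ℝ 2 (fun lam : ℂ => ρ (p + lam • v)) 0 ![1, 1]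
  + iteratedFDeriv ℝ 2 (fun lam : ℂ => ρ (p + lam • v)) 0 ![Complex.I, Complex.I]

/-- `ρ` is plurisubharmonic on `U`. -/
def PshOn {n : ℕ} (ρ : EuclideanSpace ℂ (Fin n) → ℝ) (U : Set (EuclideanSpace ℂ (Fin n))) : Prop :=
  ∀ p ∈ U, ∀ v : EuclideanSpace ℂ (Fin n), 0 ≤ sliceLaplacian ρ p v

/-- `ρ` is strictly plurisubharmonic at `p`. -/
def StrictPshAt {n : ℕ} (ρ : EuclideanSpace ℂ (Fin n) → ℝ)
    (p : EuclideanSpace ℂ (Fin n)) : Prop :=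
  ∀ v : EuclideanSpace ℂ (Fin n), v ≠ 0 → 0 < sliceLaplacian ρ p v

/-- `ρ` is strictly plurisubharmonic on a set. -/
def StrictPshOn {n : ℕ} (ρ : EuclideanSpace ℂ (Fin n) → ℝ)
    (U : Set (EuclideanSpace ℂ (Fin n))) : Prop :=
  ∀ p ∈ U, StrictPshAt ρ p

section LeviCalculus

open Filter Topology

/-- The Hessian of a composition. -/
theorem fderiv_fderiv_comp {E F G : Type*} [NormedAddCommGroup E] [NormedSpace ℝ E]
    [NormedAddCommGroup F] [NormedSpace ℝ F] [NormedAddCommGroup G] [NormedSpace ℝ G]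
    {g : F → G} {f : E → F} {p : E} (hg : ContDiffAt ℝ 2 g (f p)) (hf : ContDiffAt ℝ 2 f p)
    (v w : E) :
    fderiv ℝ (fderiv ℝ (fun x => g (f x))) p v w =
      fderiv ℝ (fderiv ℝ g) (f p) (fderiv ℝ f p v) (fderiv ℝ f p w) +
        fderiv ℝ g (f p) (fderiv ℝ (fderiv ℝ f) p v w) := by
  have hfd : ∀ᶠ x in 𝓝 p, DifferentiableAt ℝ f x :=
    (hf.eventually (by simp)).mono fun x hx => hx.differentiableAt (by simp)
  have hgd : ∀ᶠ x in 𝓝 p, DifferentiableAt ℝ g (f x) :=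
    hf.continuousAt.eventually
      ((hg.eventually (by simp)).mono fun x hx => hx.differentiableAt (by simp))
  have heq : fderiv ℝ (fun x => g (f x)) =ᶠ[𝓝 p]
      fun x => (fderiv ℝ g (f x)).comp (fderiv ℝ f x) := by
    filter_upwards [hfd, hgd] with x h1 h2
    exact fderiv_comp x h2 h1
  have hf' : DifferentiableAt ℝ (fderiv ℝ f) p :=
    (hf.fderiv_right (m := 1) (by norm_num)).differentiableAt (by simp)
  have hg' : DifferentiableAt ℝ (fderiv ℝ g) (f p) :=
    (hg.fderiv_right (m := 1) (by norm_num)).differentiableAt (by simp)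
  have hcomp : HasFDerivAt (fun x => fderiv ℝ g (f x))
      ((fderiv ℝ (fderiv ℝ g) (f p)).comp (fderiv ℝ f p)) p :=
    hg'.hasFDerivAt.comp p (hf.differentiableAt (by simp)).hasFDerivAt
  rw [heq.fderiv_eq, (hcomp.clm_comp hf'.hasFDerivAt).fderiv]
  simp [add_comm]

variable {E : Type*} [NormedAddCommGroup E] [NormedSpace ℂ E]
variable {F G : Type*} [NormedAddCommGroup F] [NormedSpace ℝ F]
  [NormedAddCommGroup G] [NormedSpace ℝ G]

/-- The Laplacian at `p` of `f` along the complex line through `p` in direction `v`. -/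
def leviLap (f : E → F) (p v : E) : F :=
  fderiv ℝ (fderiv ℝ f) p v v + fderiv ℝ (fderiv ℝ f) p (Complex.I • v) (Complex.I • v)

theorem Filter.EventuallyEq.leviLap_eq {f g : E → F} {p : E} (h : f =ᶠ[𝓝 p] g) (v : E) :
    leviLap f p v = leviLap g p v := by
  simp only [leviLap, h.fderiv.fderiv_eq]

theorem leviLap_comp {g : F → G} {f : E → F} {p : E} (hg : ContDiffAt ℝ 2 g (f p))
    (hf : ContDiffAt ℝ 2 f p) (v : E) :
    leviLap (fun x => g (f x)) p v =
      fderiv ℝ (fderiv ℝ g) (f p) (fderiv ℝ f p v) (fderiv ℝ f p v) +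
      fderiv ℝ (fderiv ℝ g) (f p) (fderiv ℝ f p (Complex.I • v)) (fderiv ℝ f p (Complex.I • v)) +
        fderiv ℝ g (f p) (leviLap f p v) := by
  simp only [leviLap, fderiv_fderiv_comp hg hf, map_add]
  abel

theorem fderiv_fderiv_clm (L : F →L[ℝ] G) (x : F) : fderiv ℝ (fderiv ℝ L) x = 0 := by
  have : fderiv ℝ L = fun _ => L := by ext1 y; exact L.fderiv
  rw [this]; simp

theorem leviLap_clm_comp (L : F →L[ℝ] G) {f : E → F} {p : E} (hf : ContDiffAt ℝ 2 f p) (v : E) :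
    leviLap (fun x => L (f x)) p v = L (leviLap f p v) := by
  rw [leviLap_comp (g := L) L.contDiff.contDiffAt hf, fderiv_fderiv_clm]
  simp

theorem leviLap_add {f g : E → F} {p : E} (hf : ContDiffAt ℝ 2 f p) (hg : ContDiffAt ℝ 2 g p)
    (v : E) : leviLap (fun x => f x + g x) p v = leviLap f p v + leviLap g p v := by
  have heq : fderiv ℝ (fun x => f x + g x) =ᶠ[𝓝 p] fun x => fderiv ℝ f x + fderiv ℝ g x := by
    filter_upwards [hf.eventually (by simp), hg.eventually (by simp)] with x h1 h2
    exact fderiv_add (h1.differentiableAt (by simp)) (h2.differentiableAt (by simp))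
  have hf' : DifferentiableAt ℝ (fderiv ℝ f) p :=
    (hf.fderiv_right (m := 1) (by norm_num)).differentiableAt (by simp)
  have hg' : DifferentiableAt ℝ (fderiv ℝ g) p :=
    (hg.fderiv_right (m := 1) (by norm_num)).differentiableAt (by simp)
  have hD : fderiv ℝ (fun x => fderiv ℝ f x + fderiv ℝ g x) p =
      fderiv ℝ (fderiv ℝ f) p + fderiv ℝ (fderiv ℝ g) p :=
    (hf'.hasFDerivAt.add hg'.hasFDerivAt).fderiv
  simp only [leviLap, heq.fderiv_eq, hD, _root_.add_apply]
  abel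

theorem leviLap_const (c : F) (p v : E) : leviLap (fun _ => c) p v = 0 := by
  simp [leviLap]

theorem leviLap_sum {ι : Type*} (s : Finset ι) {f : ι → E → F} {p : E}
    (hf : ∀ i ∈ s, ContDiffAt ℝ 2 (f i) p) (v : E) :
    leviLap (fun x => ∑ i ∈ s, f i x) p v = ∑ i ∈ s, leviLap (f i) p v := by
  classical
  induction s using Finset.induction_on with
  | empty => simp [leviLap_const]
  | insert a s ha ih =>
    have hs : ∀ i ∈ s, ContDiffAt ℝ 2 (f i) p := fun i hi => hf i (Finset.mem_insert_of_mem hi)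
    simp only [Finset.sum_insert ha]
    rw [leviLap_add (hf a (Finset.mem_insert_self _ _)) (ContDiffAt.sum hs), ih hs]

theorem leviLap_const_mul (c : ℝ) {f : E → ℝ} {p : E} (hf : ContDiffAt ℝ 2 f p) (v : E) :
    leviLap (fun x => c * f x) p v = c * leviLap f p v := by
  simpa using leviLap_clm_comp (c • ContinuousLinearMap.id ℝ ℝ) hf v

theorem leviLap_mul {A : Type*} [NormedField A] [NormedAlgebra ℝ A] {f g : E → A} {p : E}
    (hf : ContDiffAt ℝ 2 f p) (hg : ContDiffAt ℝ 2 g p) (v : E) :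
    leviLap (fun x => f x * g x) p v = f p * leviLap g p v + g p * leviLap f p v +
      2 * (fderiv ℝ f p v * fderiv ℝ g p v +
        fderiv ℝ f p (Complex.I • v) * fderiv ℝ g p (Complex.I • v)) := by
  have heq : fderiv ℝ (fun x => f x * g x) =ᶠ[𝓝 p]
      fun x => f x • fderiv ℝ g x + g x • fderiv ℝ f x := by
    filter_upwards [hf.eventually (by simp), hg.eventually (by simp)] with x h1 h2
    exact fderiv_fun_mul (h1.differentiableAt (by simp)) (h2.differentiableAt (by simp))
  have hf' : DifferentiableAt ℝ (fderiv ℝ f) p :=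
    (hf.fderiv_right (m := 1) (by norm_num)).differentiableAt (by simp)
  have hg' : DifferentiableAt ℝ (fderiv ℝ g) p :=
    (hg.fderiv_right (m := 1) (by norm_num)).differentiableAt (by simp)
  have hf0 := (hf.differentiableAt (by simp)).hasFDerivAt
  have hg0 := (hg.differentiableAt (by simp)).hasFDerivAt
  have hD : HasFDerivAt (fun x => f x • fderiv ℝ g x + g x • fderiv ℝ f x) _ p :=
    (hf0.smul hg'.hasFDerivAt).add (hg0.smul hf'.hasFDerivAt)
  simp only [leviLap, heq.fderiv_eq, hD.fderiv]
  simp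
  ring

theorem fderiv_norm_sq' {H : Type*} [NormedAddCommGroup H] [InnerProductSpace ℝ H] :
    fderiv ℝ (fun x : H => ‖x‖ ^ 2) = ((2 : ℝ) • innerSL ℝ : H →L[ℝ] H →L[ℝ] ℝ) := by
  ext x y
  simp [fderiv_norm_sq_apply]

theorem leviLap_norm_sq {H : Type*} [NormedAddCommGroup H] [InnerProductSpace ℝ H]
    {f : E → H} {p : E} (hf : ContDiffAt ℝ 2 f p) (v : E) :
    leviLap (fun x => ‖f x‖ ^ 2) p v =
      2 * (‖fderiv ℝ f p v‖ ^ 2 + ‖fderiv ℝ f p (Complex.I • v)‖ ^ 2) +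
        2 * inner ℝ (f p) (leviLap f p v) := by
  rw [leviLap_comp (g := fun x : H => ‖x‖ ^ 2) (contDiff_norm_sq ℝ).contDiffAt hf, fderiv_norm_sq',
    ContinuousLinearMap.fderiv]
  have h : ∀ x y : H, ((2 : ℝ) • innerSL ℝ : H →L[ℝ] H →L[ℝ] ℝ) x y = 2 * inner ℝ x y :=
    fun _ _ => rfl
  simp only [h, real_inner_self_eq_norm_sq]
  ring

theorem leviLap_comp_real {g : ℝ → ℝ} {f : E → ℝ} {p : E} (hg : ContDiffAt ℝ 2 g (f p))
    (hf : ContDiffAt ℝ 2 f p) (v : E) :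
    leviLap (fun x => g (f x)) p v =
      deriv (deriv g) (f p) * (fderiv ℝ f p v ^ 2 + fderiv ℝ f p (Complex.I • v) ^ 2) +
        deriv g (f p) * leviLap f p v := by
  have key : ∀ a b : ℝ, fderiv ℝ (fderiv ℝ g) (f p) a b = deriv (deriv g) (f p) * (a * b) := by
    intro a b
    have h1 : fderiv ℝ g = fun x => ContinuousLinearMap.toSpanSingleton ℝ (deriv g x) := by
      ext1 x; exact toSpanSingleton_deriv.symm
    have hg' : DifferentiableAt ℝ (deriv g) (f p) := by
      have := (hg.fderiv_right (m := 1) (by norm_num)).differentiableAt (by simp)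
      exact this.clm_apply (differentiableAt_const 1)
    have h2 : HasFDerivAt (fun x => ContinuousLinearMap.toSpanSingleton ℝ (deriv g x)) _ (f p) :=
      ((ContinuousLinearMap.toSpanSingletonCLE (𝕜 := ℝ) (E := ℝ)).toContinuousLinearMap.hasFDerivAt).comp
        (f p) hg'.hasDerivAt.hasFDerivAt
    rw [h1, h2.fderiv]
    simp
    ring
  rw [leviLap_comp hg hf, key, key]
  have : ∀ a : ℝ, fderiv ℝ g (f p) a = deriv g (f p) * a := by
    intro a; rw [fderiv_eq_smul_deriv, smul_eq_mul, mul_comm]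
  rw [this]
  ring

theorem fderiv_I_smul {K : Type*} [NormedAddCommGroup K] [NormedSpace ℂ K] {f : E → K} {p : E}
    (hd : DifferentiableAt ℂ f p) (v : E) :
    fderiv ℝ f p (Complex.I • v) = Complex.I • fderiv ℝ f p v := by
  rw [hd.fderiv_restrictScalars ℝ]
  simp

/-- The Levi Laplacian of a holomorphic map vanishes. -/
theorem leviLap_eq_zero_of_holomorphic {K : Type*} [NormedAddCommGroup K] [NormedSpace ℂ K]
    {f : E → K} {p : E} (hf : ContDiffAt ℝ 2 f p) (hd : ∀ᶠ x in 𝓝 p, DifferentiableAt ℂ f x)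
    (v : E) : leviLap f p v = 0 := by
  have hf' : DifferentiableAt ℝ (fderiv ℝ f) p :=
    (hf.fderiv_right (m := 1) (by norm_num)).differentiableAt (by simp)
  have key : ∀ a b, fderiv ℝ (fderiv ℝ f) p a (Complex.I • b) =
      Complex.I • fderiv ℝ (fderiv ℝ f) p a b := by
    intro a b
    have h1 := (hf'.hasFDerivAt.clm_apply (hasFDerivAt_const (Complex.I • b) p)).fderiv
    have h2 := ((hf'.hasFDerivAt.clm_apply (hasFDerivAt_const b p)).const_smul Complex.I).fderiv
    have heq : (fun x => fderiv ℝ f x (Complex.I • b)) =ᶠ[𝓝 p]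
        fun x => Complex.I • fderiv ℝ f x b := by
      filter_upwards [hd] with x hx
      exact fderiv_I_smul hx b
    have h3 := heq.fderiv_eq (𝕜 := ℝ)
    rw [h1] at h3
    have h4 := DFunLike.congr_fun (h3.trans h2) a
    simp only [_root_.add_apply, _root_.smul_apply, ContinuousLinearMap.flip_apply] at h4
    simpa using h4
  have hsymm : IsSymmSndFDerivAt ℝ f p := hf.isSymmSndFDerivAt (by simp)
  rw [leviLap, key, hsymm (Complex.I • v) v, key, smul_smul, Complex.I_mul_I]
  simp

/-- Precomposition with a holomorphic map. -/
theorem leviLap_comp_holomorphic {K : Type*} [NormedAddCommGroup K] [NormedSpace ℂ K]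
    {g : K → F} {f : E → K} {p : E} (hg : ContDiffAt ℝ 2 g (f p)) (hf : ContDiffAt ℝ 2 f p)
    (hd : ∀ᶠ x in 𝓝 p, DifferentiableAt ℂ f x) (v : E) :
    leviLap (fun x => g (f x)) p v = leviLap g (f p) (fderiv ℝ f p v) := by
  rw [leviLap_comp hg hf, leviLap_eq_zero_of_holomorphic hf hd, fderiv_I_smul hd.self_of_nhds,
    map_zero, add_zero, leviLap]

theorem sliceLaplacian_eq_leviLap {n : ℕ} {ρ : EuclideanSpace ℂ (Fin n) → ℝ}
    {p : EuclideanSpace ℂ (Fin n)} (hρ : ContDiffAt ℝ 2 ρ p) (v : EuclideanSpace ℂ (Fin n)) :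
    sliceLaplacian ρ p v = leviLap ρ p v := by
  have hf : ContDiffAt ℝ 2 (fun lam : ℂ => p + lam • v) 0 := by fun_prop
  have hp : (fun lam : ℂ => p + lam • v) 0 = p := by simp
  have hd : ∀ x : ℂ, HasFDerivAt (fun lam : ℂ => p + lam • v)
      ((ContinuousLinearMap.toSpanSingleton ℂ v).restrictScalars ℝ) x := fun x => by
    have h : HasFDerivAt (fun lam : ℂ => p + lam • v)
      (ContinuousLinearMap.toSpanSingleton ℂ v) x := by
      simpa using ((ContinuousLinearMap.toSpanSingleton ℂ v).hasFDerivAt (x := x)).const_add p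
    exact h.restrictScalars ℝ
  have hd' : fderiv ℝ (fun lam : ℂ => p + lam • v) =
      fun _ => (ContinuousLinearMap.toSpanSingleton ℂ v).restrictScalars ℝ := by
    ext1 x; exact (hd x).fderiv
  have hg : ContDiffAt ℝ 2 ρ ((fun lam : ℂ => p + lam • v) 0) := by rwa [hp]
  have key : ∀ a : ℂ, fderiv ℝ (fderiv ℝ (fun lam : ℂ => ρ (p + lam • v))) 0 a a =
      fderiv ℝ (fderiv ℝ ρ) p (a • v) (a • v) := by
    intro a
    rw [fderiv_fderiv_comp (f := fun lam : ℂ => p + lam • v) hg hf a a, hd']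
    simp
  simp only [sliceLaplacian, iteratedFDeriv_two_apply]
  simp [key, leviLap]

theorem continuousAt_leviLap {ρ : E → F} {p : E} (hρ : ContDiffAt ℝ 2 ρ p) (v : E) :
    ContinuousAt (fun q : E × E => leviLap ρ q.1 q.2) (p, v) := by
  have h : ContinuousAt (fderiv ℝ (fderiv ℝ ρ)) p :=
    ((hρ.fderiv_right (m := 1) (by norm_num)).fderiv_right (m := 0) (by norm_num)).continuousAt
  have h' : ContinuousAt (fun q : E × E => fderiv ℝ (fderiv ℝ ρ) q.1) (p, v) :=
    ContinuousAt.comp (f := Prod.fst) (x := (p, v)) h continuousAt_fst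
  unfold leviLap
  have h2 : ContinuousAt (fun q : E × E => Complex.I • q.2) (p, v) := by fun_prop
  exact ((h'.clm_apply continuousAt_snd).clm_apply continuousAt_snd).add
    ((h'.clm_apply h2).clm_apply h2)

theorem leviLap_real_smul (ρ : E → F) (p v : E) (t : ℝ) :
    leviLap ρ p (t • v) = (t ^ 2) • leviLap ρ p v := by
  simp only [leviLap, smul_comm Complex.I t v, map_smul, _root_.smul_apply, smul_add]
  simp only [smul_smul, sq]

/-- It suffices to test strict positivity on the unit sphere. -/
theorem leviLap_pos_of_sphere {ρ : E → ℝ} {p : E}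
    (h : ∀ v ∈ Metric.sphere (0 : E) 1, 0 < leviLap ρ p v) {v : E} (hv : v ≠ 0) :
    0 < leviLap ρ p v := by
  have hn : 0 < ‖v‖ := norm_pos_iff.2 hv
  have h1 := h ((‖v‖⁻¹ : ℝ) • v) (by simp [norm_smul, hn.ne'])
  rw [leviLap_real_smul, smul_eq_mul] at h1
  exact (pos_iff_pos_of_mul_pos h1).1 (by positivity)

/-- Strict plurisubharmonicity is an open condition. -/
theorem eventually_leviLap_pos [FiniteDimensional ℂ E] {ρ : E → ℝ} {p : E}
    (hρ : ContDiffAt ℝ 2 ρ p) (h : ∀ v, v ≠ 0 → 0 < leviLap ρ p v) :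
    ∀ᶠ x in 𝓝 p, ∀ v, v ≠ 0 → 0 < leviLap ρ x v := by
  have : ProperSpace E := FiniteDimensional.proper ℂ E
  have hs : IsCompact (Metric.sphere (0 : E) 1) := isCompact_sphere 0 1
  have key : ∀ᶠ x in 𝓝 p, ∀ v ∈ Metric.sphere (0 : E) 1, 0 < leviLap ρ x v := by
    refine hs.eventually_forall_of_forall_eventually fun v hv => ?_
    have hv0 : v ≠ 0 := by
      rintro rfl; simp at hv
    exact (continuousAt_leviLap hρ v).eventually (lt_mem_nhds (h v hv0))
  filter_upwards [key] with x hx v hv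
  exact leviLap_pos_of_sphere hx hv

end LeviCalculus

section SeveralComplexVariables

open Filter Topology Metric

variable {E F : Type*} [NormedAddCommGroup E] [NormedSpace ℂ E]
  [NormedAddCommGroup F] [NormedSpace ℂ F]

theorem fderiv_apply_eq_deriv_line {f : E → F} {x : E} (hf : DifferentiableAt ℂ f x) (v : E) :
    fderiv ℂ f x v = deriv (fun t : ℂ => f (x + t • v)) 0 := by
  have h : HasDerivAt (fun t : ℂ => x + t • v) v 0 := by
    simpa using ((hasDerivAt_id (0 : ℂ)).smul_const v).const_add x
  have hf' : HasFDerivAt f (fderiv ℂ f x) (x + (0 : ℂ) • v) := by simpa using hf.hasFDerivAt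
  exact (hf'.comp_hasDerivAt 0 h).deriv.symm

theorem differentiableOn_line {f : E → F} {U : Set E} (hU : IsOpen U)
    (hf : DifferentiableOn ℂ f U) {x v : E} {r : ℝ}
    (h : ∀ t ∈ closedBall (0 : ℂ) r, x + t • v ∈ U) :
    DiffContOnCl ℂ (fun t : ℂ => f (x + t • v)) (ball 0 r) := by
  refine DifferentiableOn.diffContOnCl_ball (U := closedBall 0 r) (fun t ht => ?_) subset_rfl
  have h1 : DifferentiableAt ℂ f (x + t • v) := hf.differentiableAt (hU.mem_nhds (h t ht))
  have h2 : DifferentiableAt ℂ (fun t : ℂ => x + t • v) t := by fun_prop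
  exact (h1.comp t h2).differentiableWithinAt

/-- A uniform radius for discs in a fixed direction around nearby points. -/
theorem exists_disc_radius {x₀ : E} (v : E) {U : Set E} (hU : U ∈ 𝓝 x₀) :
    ∃ r > 0, ∃ ε > 0, ∀ x ∈ ball x₀ ε, ∀ t ∈ closedBall (0 : ℂ) r, x + t • v ∈ U := by
  have hc : Tendsto (fun q : E × ℂ => q.1 + q.2 • v) (𝓝 (x₀, 0)) (𝓝 x₀) := by
    have : Continuous (fun q : E × ℂ => q.1 + q.2 • v) := by fun_prop
    simpa using this.tendsto (x₀, 0)
  have := hc hU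
  rw [Filter.mem_map, nhds_prod_eq, (nhds_basis_ball.prod nhds_basis_closedBall).mem_iff] at this
  obtain ⟨⟨ε, r⟩, ⟨hε, hr⟩, hsub⟩ := this
  exact ⟨r, hr, ε, hε, fun x hx t ht => hsub (Set.mk_mem_prod hx ht)⟩

theorem continuousOn_fderiv_apply_of_holomorphic [FiniteDimensional ℂ E] {f : E → F} {U : Set E}
    (hU : IsOpen U) (hf : DifferentiableOn ℂ f U) (v : E) :
    ContinuousOn (fun x => fderiv ℂ f x v) U := by
  have : ProperSpace E := FiniteDimensional.proper ℂ E
  intro x₀ hx₀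
  apply ContinuousAt.continuousWithinAt
  obtain ⟨r, hr, ε, hε, hsub⟩ := exists_disc_radius v (hU.mem_nhds hx₀)
  rw [Metric.continuousAt_iff']
  intro η hη
  have hsph : IsCompact (sphere (0 : ℂ) r) := isCompact_sphere 0 r
  have key : ∀ᶠ x in 𝓝 x₀, ∀ t ∈ sphere (0 : ℂ) r,
      ‖f (x + t • v) - f (x₀ + t • v)‖ < η * r / 2 := by
    refine hsph.eventually_forall_of_forall_eventually fun t ht => ?_
    have hmem : x₀ + t • v ∈ U := hsub x₀ (mem_ball_self hε) t (sphere_subset_closedBall ht)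
    have hfc : ContinuousAt f (x₀ + t • v) :=
      (hf.differentiableAt (hU.mem_nhds hmem)).continuousAt
    have h1 : ContinuousAt (fun q : E × ℂ => f (q.1 + q.2 • v)) (x₀, t) :=
      ContinuousAt.comp (f := fun q : E × ℂ => q.1 + q.2 • v) (x := (x₀, t)) hfc (by fun_prop)
    have h2 : ContinuousAt (fun q : E × ℂ => f (x₀ + q.2 • v)) (x₀, t) :=
      ContinuousAt.comp (f := fun q : E × ℂ => x₀ + q.2 • v) (x := (x₀, t)) hfc (by fun_prop)
    have h3 := (h1.sub h2).norm
    refine h3.eventually (gt_mem_nhds ?_)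
    show ‖f (x₀ + t • v) - f (x₀ + t • v)‖ < η * r / 2
    rw [sub_self, norm_zero]
    positivity
  filter_upwards [key, ball_mem_nhds x₀ hε] with x hx hxε
  have hd1 := differentiableOn_line hU hf (hsub x hxε)
  have hd2 := differentiableOn_line hU hf (hsub x₀ (mem_ball_self hε))
  have h0 : ∀ y ∈ ball x₀ ε, DifferentiableAt ℂ f y := fun y hy =>
    hf.differentiableAt (hU.mem_nhds (by simpa using hsub y hy 0 (mem_closedBall_self hr.le)))
  have hda := hd1.differentiableAt isOpen_ball (mem_ball_self hr)
  have hdb := hd2.differentiableAt isOpen_ball (mem_ball_self hr)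
  have hest := Complex.norm_deriv_le_of_forall_mem_sphere_norm_le hr (hd1.sub hd2)
    (C := η * r / 2) (fun t ht => (hx t ht).le)
  rw [deriv_sub hda hdb] at hest
  rw [dist_eq_norm, fderiv_apply_eq_deriv_line (h0 x hxε) v,
    fderiv_apply_eq_deriv_line (h0 x₀ (mem_ball_self hε)) v]
  refine hest.trans_lt ?_
  rw [div_lt_iff₀ hr]
  nlinarith [mul_pos hη hr]

theorem differentiableOn_fderiv_apply_of_holomorphic [FiniteDimensional ℂ E] [CompleteSpace F]
    {f : E → F} {U : Set E} (hU : IsOpen U) (hf : DifferentiableOn ℂ f U) (v : E) :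
    DifferentiableOn ℂ (fun x => fderiv ℂ f x v) U := by
  have : ProperSpace E := FiniteDimensional.proper ℂ E
  have hcont : ContinuousOn (fderiv ℂ f) U :=
    continuousOn_clm_apply.2 fun y => continuousOn_fderiv_apply_of_holomorphic hU hf y
  intro x₀ hx₀
  obtain ⟨K, hK, hKU, hKx⟩ := exists_compact_subset hU hx₀
  obtain ⟨r, hr, ε, hε, hsub⟩ := exists_disc_radius v (mem_interior_iff_mem_nhds.1 hKU)
  obtain ⟨C, hC⟩ := (hK.image_of_continuousOn (hcont.mono hKx)).isBounded.exists_norm_le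
  have hC' : ∀ y ∈ K, ‖fderiv ℂ f y‖ ≤ C := fun y hy => hC _ ⟨y, hy, rfl⟩
  set c : ℝ → ℂ := fun θ => deriv (circleMap 0 r) θ * (circleMap 0 r θ ^ 2)⁻¹ with hc
  have hcm : ∀ θ, circleMap 0 r θ ∈ closedBall (0 : ℂ) r := fun θ => by
    simp [abs_of_pos hr]
  have hcc : Continuous c := by
    have h0 : ∀ θ, circleMap (0 : ℂ) r θ ^ 2 ≠ 0 := fun θ =>
      pow_ne_zero 2 (circleMap_ne_center hr.ne')
    have : Continuous (fun θ => circleMap (0 : ℂ) r θ ^ 2) := by fun_prop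
    have h1 : Continuous (deriv (circleMap (0 : ℂ) r)) := by
      have : deriv (circleMap (0 : ℂ) r) = fun θ => circleMap 0 r θ * Complex.I := by
        ext θ; exact deriv_circleMap 0 r θ
      rw [this]; fun_prop
    exact h1.mul (this.inv₀ h0)
  have hline : ∀ x ∈ ball x₀ ε, Continuous fun θ : ℝ => f (x + circleMap 0 r θ • v) := by
    intro x hx
    refine hf.continuousOn.comp_continuous (by fun_prop) fun θ => hKx (hsub x hx _ (hcm θ))
  have hline' : Continuous fun θ : ℝ => fderiv ℂ f (x₀ + circleMap 0 r θ • v) := by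
    refine hcont.comp_continuous (by fun_prop)
      fun θ => hKx (hsub x₀ (mem_ball_self hε) _ (hcm θ))
  have hderiv_int := intervalIntegral.hasFDerivAt_integral_of_dominated_of_fderiv_le
    (𝕜 := ℂ) (μ := MeasureTheory.volume) (a := 0) (b := 2 * Real.pi)
    (F := fun x θ => c θ • f (x + circleMap 0 r θ • v))
    (F' := fun x θ => c θ • fderiv ℂ f (x + circleMap 0 r θ • v)) (x₀ := x₀)
    (bound := fun θ => ‖c θ‖ * C) (ball_mem_nhds x₀ hε)
    (by filter_upwards [ball_mem_nhds x₀ hε] with x hx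
        exact (hcc.smul (hline x hx)).aestronglyMeasurable)
    ((hcc.smul (hline x₀ (mem_ball_self hε))).intervalIntegrable _ _)
    (hcc.smul hline').aestronglyMeasurable
    (Eventually.of_forall fun θ _ x hx => by
      rw [norm_smul]
      exact mul_le_mul_of_nonneg_left (hC' _ (hsub x hx _ (hcm θ))) (norm_nonneg _))
    ((hcc.norm.mul continuous_const).intervalIntegrable _ _)
    (Eventually.of_forall fun θ _ x hx => by
      have h1 : DifferentiableAt ℂ f (x + circleMap 0 r θ • v) :=
        hf.differentiableAt (hU.mem_nhds (hKx (hsub x hx _ (hcm θ))))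
      have h2 : HasFDerivAt (fun x : E => x + circleMap 0 r θ • v)
          (ContinuousLinearMap.id ℂ E) x := (hasFDerivAt_id x).add_const _
      exact (h1.hasFDerivAt.comp x h2).const_smul (c θ))
  have heq : (fun x => fderiv ℂ f x v) =ᶠ[𝓝 x₀] fun x =>
      (2 * Real.pi * Complex.I : ℂ)⁻¹ • ∫ θ in 0..2 * Real.pi,
        c θ • f (x + circleMap 0 r θ • v) := by
    filter_upwards [ball_mem_nhds x₀ hε] with x hx
    have hxU : x ∈ U := hKx (by simpa using hsub x hx 0 (mem_closedBall_self hr.le))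
    have hd := differentiableOn_line hU hf fun t ht => hKx (hsub x hx t ht)
    have hcauchy := hd.circleIntegral_one_div_sub_center_pow_smul hr 1
    rw [iteratedDeriv_one, Nat.factorial_one, Nat.cast_one, div_one, circleIntegral] at hcauchy
    rw [fderiv_apply_eq_deriv_line (hf.differentiableAt (hU.mem_nhds hxU)) v,
      eq_inv_smul_iff₀ Complex.two_pi_I_ne_zero, ← hcauchy]
    refine intervalIntegral.integral_congr fun θ _ => ?_
    simp [hc, smul_smul]
  exact ((heq.differentiableAt_iff).2 (hderiv_int.differentiableAt.const_smul _)).differentiableWithinAt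

/-- Holomorphic maps of several variables are smooth. -/
theorem contDiffOn_of_holomorphic [FiniteDimensional ℂ E] [CompleteSpace F]
    {f : E → F} {U : Set E} (hU : IsOpen U) (hf : DifferentiableOn ℂ f U) (n : ℕ) :
    ContDiffOn ℂ n f U := by
  induction n generalizing f with
  | zero => simpa using hf.continuousOn
  | succ n ih =>
    have := (contDiffOn_succ_iff_fderiv_of_isOpen (𝕜 := ℂ) (n := n) (f := f) hU).2
      ⟨hf, by simp, contDiffOn_clm_apply.2 fun v =>
        ih (differentiableOn_fderiv_apply_of_holomorphic hU hf v)⟩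
    exact_mod_cast this

theorem contDiffAt_real_of_holomorphic [FiniteDimensional ℂ E] [CompleteSpace F]
    {f : E → F} {U : Set E} (hU : IsOpen U) (hf : DifferentiableOn ℂ f U) {x : E} (hx : x ∈ U) :
    ContDiffAt ℝ (⊤ : ℕ∞) f x := by
  have h : ContDiffAt ℂ (⊤ : ℕ∞) f x :=
    (contDiffOn_infty.2 (contDiffOn_of_holomorphic hU hf)).contDiffAt (hU.mem_nhds hx)
  exact h.restrict_scalars ℝ

end SeveralComplexVariables

section LeviEstimates

open Filter Topology Metric

variable {E : Type*} [NormedAddCommGroup E] [NormedSpace ℂ E]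

theorem leviLap_holomorphic_scalar {g : E → ℂ} (hg : ContDiff ℂ 2 g) (p v : E) :
    leviLap g p v = 0 :=
  leviLap_eq_zero_of_holomorphic (hg.restrict_scalars ℝ).contDiffAt
    (Eventually.of_forall fun _ => hg.contDiffAt.differentiableAt (by simp)) v

theorem hasFDerivAt_real_of_holomorphic {g : E → ℂ} (hg : ContDiff ℂ 2 g) (p : E) :
    HasFDerivAt g ((fderiv ℂ g p).restrictScalars ℝ) p :=
  (hg.contDiffAt.differentiableAt (by simp)).hasFDerivAt.restrictScalars ℝ

theorem hasFDerivAt_conj_of_holomorphic {g : E → ℂ} (hg : ContDiff ℂ 2 g) (p : E) :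
    HasFDerivAt (fun x => conj (g x))
      ((Complex.conjCLE : ℂ →L[ℝ] ℂ).comp ((fderiv ℂ g p).restrictScalars ℝ)) p :=
  (Complex.conjCLE : ℂ →L[ℝ] ℂ).hasFDerivAt.comp p (hasFDerivAt_real_of_holomorphic hg p)

theorem contDiff_conj_of_holomorphic {g : E → ℂ} (hg : ContDiff ℂ 2 g) :
    ContDiff ℝ 2 (fun x => conj (g x)) :=
  (Complex.conjCLE : ℂ →L[ℝ] ℂ).contDiff.comp (hg.restrict_scalars ℝ)

theorem leviLap_conj_of_holomorphic {g : E → ℂ} (hg : ContDiff ℂ 2 g) (p v : E) :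
    leviLap (fun x => conj (g x)) p v = 0 := by
  have := leviLap_clm_comp (Complex.conjCLE : ℂ →L[ℝ] ℂ)
    (hg.restrict_scalars ℝ).contDiffAt (p := p) v
  rw [leviLap_holomorphic_scalar hg, map_zero] at this
  exact this

theorem norm_sub_sq_add_norm_I_mul_sq (a b : ℂ) :
    ‖a - b‖ ^ 2 + ‖Complex.I * (a + b)‖ ^ 2 = 2 * (‖a‖ ^ 2 + ‖b‖ ^ 2) := by
  have := parallelogram_law_with_norm ℝ a b
  rw [norm_mul, Complex.norm_I, one_mul]
  nlinarith

/-- The Levi Laplacian of `‖a - z̄ c‖²` for holomorphic `a`, `z`, `c`. -/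
theorem leviLap_norm_sub_conj_mul_sq {a z c : E → ℂ} (ha : ContDiff ℂ 2 a) (hz : ContDiff ℂ 2 z)
    (hc : ContDiff ℂ 2 c) (p v : E) :
    leviLap (fun x => ‖a x - conj (z x) * c x‖ ^ 2) p v =
      4 * (‖fderiv ℂ a p v - conj (z p) * fderiv ℂ c p v‖ ^ 2 +
        ‖conj (fderiv ℂ z p v) * c p‖ ^ 2) +
      2 * inner ℝ (a p - conj (z p) * c p) (-4 * (conj (fderiv ℂ z p v) * fderiv ℂ c p v)) := by
  have hz' := contDiff_conj_of_holomorphic hz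
  have ha' := ha.restrict_scalars ℝ
  have hc' := hc.restrict_scalars ℝ
  have hzD := hasFDerivAt_conj_of_holomorphic hz p
  have haD := hasFDerivAt_real_of_holomorphic ha p
  have hcD := hasFDerivAt_real_of_holomorphic hc p
  have hlev : leviLap (fun x => a x - conj (z x) * c x) p v =
      -4 * (conj (fderiv ℂ z p v) * fderiv ℂ c p v) := by
    have h1 := leviLap_clm_comp (-ContinuousLinearMap.id ℝ ℂ) (hz'.mul hc').contDiffAt (p := p) v
    have h2 := leviLap_add (p := p) ha'.contDiffAt (hz'.mul hc').neg.contDiffAt v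
    simp only [neg_apply, ContinuousLinearMap.id_apply] at h1
    simp only [sub_eq_add_neg]
    rw [h2, h1, leviLap_mul hz'.contDiffAt hc'.contDiffAt, leviLap_holomorphic_scalar ha,
      leviLap_holomorphic_scalar hc, leviLap_conj_of_holomorphic hz, hzD.fderiv, hcD.fderiv]
    simp
    linear_combination (-2 * (conj (fderiv ℂ z p v) * fderiv ℂ c p v)) * Complex.I_sq
  have hD := haD.sub (hzD.mul hcD)
  have hD' : HasFDerivAt (fun x => a x - conj (z x) * c x) _ p := hD
  rw [leviLap_norm_sq (ha'.sub (hz'.mul hc')).contDiffAt, hlev, hD'.fderiv]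
  congr 1
  have := norm_sub_sq_add_norm_I_mul_sq (fderiv ℂ a p v - conj (z p) * fderiv ℂ c p v)
    (conj (fderiv ℂ z p v) * c p)
  rw [show (4 : ℝ) = 2 * 2 by norm_num, mul_assoc 2 2, ← this]
  congr 1
  congr 3 <;>
    simp only [sub_apply, add_apply,
      smul_apply, ContinuousLinearMap.comp_apply,
      ContinuousLinearMap.coe_restrictScalars', ContinuousLinearEquiv.coe_coe, map_smul,
      Complex.conjCLE_apply, smul_eq_mul, map_mul, Complex.conj_I] <;> ring

/-- The Levi Laplacian of `‖g - h̄‖²` for holomorphic `g`, `h`. -/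
theorem leviLap_norm_sub_conj_sq {g h : E → ℂ} (hg : ContDiff ℂ 2 g) (hh : ContDiff ℂ 2 h)
    (p v : E) :
    leviLap (fun x => ‖g x - conj (h x)‖ ^ 2) p v =
      4 * (‖fderiv ℂ g p v‖ ^ 2 + ‖fderiv ℂ h p v‖ ^ 2) := by
  have := leviLap_norm_sub_conj_mul_sq hg hh (c := fun _ => 1) contDiff_const p v
  simpa using this

theorem leviLap_norm_sub_conj_mul_sq_ge {a z c : E → ℂ} (ha : ContDiff ℂ 2 a)
    (hz : ContDiff ℂ 2 z) (hc : ContDiff ℂ 2 c) (p v : E) :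
    4 * (‖c p‖ ^ 2 * ‖fderiv ℂ z p v‖ ^ 2) -
      8 * (‖a p - conj (z p) * c p‖ * (‖fderiv ℂ c p v‖ * ‖fderiv ℂ z p v‖)) ≤
    leviLap (fun x => ‖a x - conj (z x) * c x‖ ^ 2) p v := by
  rw [leviLap_norm_sub_conj_mul_sq ha hz hc]
  have h1 := abs_le.1 (abs_real_inner_le_norm (a p - conj (z p) * c p)
    (-4 * (conj (fderiv ℂ z p v) * fderiv ℂ c p v)))
  simp only [norm_mul, norm_neg, RCLike.norm_conj, Complex.norm_ofNat] at h1 ⊢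
  nlinarith [h1.1, sq_nonneg ‖fderiv ℂ a p v - conj (z p) * fderiv ℂ c p v‖]

end LeviEstimates

section ModelEstimate

open Filter Topology Metric

variable {n : ℕ}

theorem leviLap_norm_sq_self (p v : EuclideanSpace ℂ (Fin n)) :
    leviLap (fun x : EuclideanSpace ℂ (Fin n) => ‖x‖ ^ 2) p v = 4 * ‖v‖ ^ 2 := by
  have h := leviLap_norm_sq (f := fun x : EuclideanSpace ℂ (Fin n) => x) (p := p)
    contDiffAt_id v
  have h0 : leviLap (fun x : EuclideanSpace ℂ (Fin n) => x) p v = 0 :=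
    leviLap_eq_zero_of_holomorphic contDiffAt_id
      (Eventually.of_forall fun _ => differentiableAt_id) v
  have h1 : fderiv ℝ (fun x : EuclideanSpace ℂ (Fin n) => x) p =
      ContinuousLinearMap.id ℝ _ := fderiv_fun_id
  rw [h0, h1, inner_zero_right] at h
  rw [h]
  simp only [ContinuousLinearMap.id_apply, norm_smul, Complex.norm_I, one_mul]
  ring

theorem abs_fderiv_norm_sq_le (p v : EuclideanSpace ℂ (Fin n)) :
    |fderiv ℝ (fun x : EuclideanSpace ℂ (Fin n) => ‖x‖ ^ 2) p v| ≤ 2 * (‖p‖ * ‖v‖) := by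
  rw [fderiv_norm_sq']
  have h : ((2 : ℝ) • innerSL ℝ : EuclideanSpace ℂ (Fin n) →L[ℝ] _ →L[ℝ] ℝ) p v =
    2 * inner ℝ p v := rfl
  rw [h, abs_mul, abs_two]
  exact mul_le_mul_of_nonneg_left (abs_real_inner_le_norm p v) zero_le_two

theorem leviLap_sq_mul_ge {r : EuclideanSpace ℂ (Fin n) → ℝ} {p : EuclideanSpace ℂ (Fin n)}
    (hr : ContDiffAt ℝ 2 r p) (h0 : 0 ≤ r p) {v : EuclideanSpace ℂ (Fin n)}
    (hlev : 0 ≤ leviLap r p v) (hp : ‖p‖ ≤ 1 / 4) :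
    2 * (r p ^ 2 * ‖v‖ ^ 2) ≤ leviLap (fun x => r x * r x * (1 + ‖x‖ ^ 2)) p v := by
  have hs : ContDiffAt ℝ 2 (fun x : EuclideanSpace ℂ (Fin n) => ‖x‖ ^ 2) p :=
    (contDiff_norm_sq ℝ).contDiffAt
  have hs' : ContDiffAt ℝ 2 (fun x : EuclideanSpace ℂ (Fin n) => 1 + ‖x‖ ^ 2) p :=
    contDiffAt_const.add hs
  have hD : fderiv ℝ (fun x : EuclideanSpace ℂ (Fin n) => 1 + ‖x‖ ^ 2) p =
    fderiv ℝ (fun x : EuclideanSpace ℂ (Fin n) => ‖x‖ ^ 2) p := fderiv_const_add _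
  have hDr : ∀ w, fderiv ℝ (fun x => r x * r x) p w = 2 * (r p * fderiv ℝ r p w) := fun w => by
    rw [fderiv_fun_mul (hr.differentiableAt (by simp)) (hr.differentiableAt (by simp))]
    simp only [add_apply, smul_apply, smul_eq_mul]
    ring
  rw [leviLap_mul (hr.mul hr) hs', leviLap_mul hr hr, leviLap_add contDiffAt_const hs,
    leviLap_const, leviLap_norm_sq_self, hD, hDr, hDr]
  have b1 := abs_fderiv_norm_sq_le p v
  have b2 := abs_fderiv_norm_sq_le p (Complex.I • v)
  rw [norm_smul, Complex.norm_I, one_mul] at b2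
  set d1 := fderiv ℝ (fun x : EuclideanSpace ℂ (Fin n) => ‖x‖ ^ 2) p v
  set d2 := fderiv ℝ (fun x : EuclideanSpace ℂ (Fin n) => ‖x‖ ^ 2) p (Complex.I • v)
  set e1 := fderiv ℝ r p v
  set e2 := fderiv ℝ r p (Complex.I • v)
  set R := r p
  have hpv : ‖p‖ * ‖v‖ ≤ 1 / 4 * ‖v‖ := mul_le_mul_of_nonneg_right hp (norm_nonneg v)
  have c1 : d1 ^ 2 ≤ 1 / 4 * ‖v‖ ^ 2 := by
    have := sq_le_sq' (abs_le.1 (b1.trans (by linarith : _ ≤ 1 / 2 * ‖v‖))).1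
      (abs_le.1 (b1.trans (by linarith : _ ≤ 1 / 2 * ‖v‖))).2
    linarith [this, mul_pow (1 / 2) ‖v‖ 2]
  have c2 : d2 ^ 2 ≤ 1 / 4 * ‖v‖ ^ 2 := by
    have := sq_le_sq' (abs_le.1 (b2.trans (by linarith : _ ≤ 1 / 2 * ‖v‖))).1
      (abs_le.1 (b2.trans (by linarith : _ ≤ 1 / 2 * ‖v‖))).2
    linarith [this, mul_pow (1 / 2) ‖v‖ 2]
  have f1 := mul_le_mul_of_nonneg_left c1 (sq_nonneg R)
  have f2 := mul_le_mul_of_nonneg_left c2 (sq_nonneg R)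
  have g1 : 0 ≤ (1 + ‖p‖ ^ 2) * (R * leviLap r p v) :=
    mul_nonneg (by positivity) (mul_nonneg h0 hlev)
  have g2 : 0 ≤ ‖p‖ ^ 2 * (e1 ^ 2 + e2 ^ 2) := by positivity
  nlinarith [sq_nonneg (e1 + R * d1), sq_nonneg (e2 + R * d2)]

theorem model_scalar_estimate {x y a c s t k R : ℝ} (ha : 0 ≤ a)
    (hc : 0 ≤ c) (hs : 0 ≤ s) (ht : 0 ≤ t) (ha1 : a ≤ 1) (hc1 : c ≤ 1) (ht1 : t ≤ 1) (hcs : c ≤ s + t)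
    (hsk : s ^ 4 ≤ 2 * R + 2 * k ^ 2) (hkt : k ^ 2 ≤ 2 * R + 2 * t ^ 4) :
    64 * (a ^ 14 * c * (x + y) * x) ≤
      2 * (a ^ 16 * x ^ 2) + 1024 * y ^ 2 + 64 ^ 8 * 128 * ((72 * R ^ 2 + 33 * t ^ 2) * x ^ 2) := by
  have e1 : 64 * (a ^ 14 * c * y * x) ≤ a ^ 16 * x ^ 2 + 1024 * y ^ 2 := by
    have h1 : (a ^ 6 * c) ^ 2 ≤ 1 := by
      have : a ^ 6 * c ≤ 1 := mul_le_one₀ (pow_le_one₀ ha ha1) hc hc1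
      exact pow_le_one₀ (by positivity) this
    have h2 := mul_le_mul_of_nonneg_right h1 (sq_nonneg y)
    nlinarith [sq_nonneg (a ^ 8 * x - 32 * (a ^ 6 * c * y))]
  have e2 : 64 * (a ^ 14 * c) ≤ a ^ 16 + (64 * c) ^ 8 := by
    rcases le_total (64 * c) (a ^ 2) with h | h
    · have := mul_le_mul_of_nonneg_left h (pow_nonneg ha 14)
      have h' : 0 ≤ (64 * c) ^ 8 := by positivity
      nlinarith
    · have h1 : (a ^ 2) ^ 7 ≤ (64 * c) ^ 7 := pow_le_pow_left₀ (by positivity) h 7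
      have := mul_le_mul_of_nonneg_right h1 (by positivity : 0 ≤ 64 * c)
      have h' : 0 ≤ a ^ 16 := by positivity
      nlinarith
  have e3 : c ^ 8 ≤ 128 * (s ^ 8 + t ^ 8) := by
    have h1 : c ^ 8 ≤ (s + t) ^ 8 := pow_le_pow_left₀ hc hcs 8
    have h2 := add_pow_le hs ht 8
    norm_num at h2
    linarith
  have e4 : t ^ 8 ≤ t ^ 2 := pow_le_pow_of_le_one ht ht1 (by norm_num)
  have e5 : s ^ 8 ≤ 72 * R ^ 2 + 32 * t ^ 8 := by
    have h1 : s ^ 4 ≤ 6 * R + 4 * t ^ 4 := by linarith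
    have h2 : (s ^ 4) ^ 2 ≤ (6 * R + 4 * t ^ 4) ^ 2 := pow_le_pow_left₀ (by positivity) h1 2
    nlinarith [sq_nonneg (6 * R - 4 * t ^ 4)]
  have e6 : c ^ 8 ≤ 128 * (72 * R ^ 2 + 33 * t ^ 2) := by linarith
  have e7 := mul_le_mul_of_nonneg_right e2 (sq_nonneg x)
  have e8 := mul_le_mul_of_nonneg_right e6 (sq_nonneg x)
  rw [mul_pow] at e7
  nlinarith

/-- The constant weighting the convex part of the model function. -/
def modelConst : ℝ := 64 ^ 8 * 128 * 72 + 1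

theorem leviLap_model_ge (z b s k : EuclideanSpace ℂ (Fin n) →L[ℂ] ℂ)
    {r : EuclideanSpace ℂ (Fin n) → ℝ} (hr : ContDiff ℝ 2 r) {p v : EuclideanSpace ℂ (Fin n)}
    (h0 : 0 ≤ r p) (hlev : 4 * ‖b v‖ ^ 2 + 16 * (‖z p‖ ^ 2 * ‖z v‖ ^ 2) ≤ leviLap r p v)
    (hP : ‖s p ^ 2 - k p * (z p + b p) ^ 2‖ ^ 2 ≤ r p) (hB : ‖k p - conj (z p ^ 2)‖ ^ 2 ≤ r p)
    (hp : ‖p‖ ≤ 1 / 4) (hz1 : ‖z p‖ ≤ 1) (ha1 : ‖z p + b p‖ ≤ 1)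
    (hF1 : ‖s p - conj (z p) * (z p + b p)‖ ≤ 1) (hzv : ‖z v‖ ≤ ‖v‖) :
    leviLap r p v + r p ^ 2 * ‖v‖ ^ 2 + ‖z p + b p‖ ^ 16 * ‖z v‖ ^ 2 ≤
      leviLap (fun x => modelConst * (r x + r x * r x * (1 + ‖x‖ ^ 2)) +
        ‖(z x + b x) ^ 7 * s x - conj (z x) * (z x + b x) ^ 8‖ ^ 2) p v := by
  have hlev0 : 0 ≤ leviLap r p v := le_trans (by positivity) hlev
  have hs : ContDiff ℝ 2 (fun x : EuclideanSpace ℂ (Fin n) => ‖x‖ ^ 2) := contDiff_norm_sq ℝ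
  have hq : ContDiff ℝ 2 (fun x => r x * r x * (1 + ‖x‖ ^ 2)) :=
    (hr.mul hr).mul (contDiff_const.add hs)
  have hω : ContDiff ℂ 2 (fun x => z x + b x) := z.contDiff.add b.contDiff
  have hc : ContDiff ℂ 2 (fun x => (z x + b x) ^ 8) := hω.pow 8
  have ha : ContDiff ℂ 2 (fun x => (z x + b x) ^ 7 * s x) := (hω.pow 7).mul s.contDiff
  have hG : ContDiff ℝ 2 (fun x => ‖(z x + b x) ^ 7 * s x - conj (z x) * (z x + b x) ^ 8‖ ^ 2) :=
    (((ha.restrict_scalars ℝ).sub ((contDiff_conj_of_holomorphic z.contDiff).mul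
      (hc.restrict_scalars ℝ))).norm_sq ℝ)
  rw [leviLap_add (contDiff_const.mul (hr.add hq)).contDiffAt hG.contDiffAt,
    leviLap_const_mul _ (hr.add hq).contDiffAt, leviLap_add hr.contDiffAt hq.contDiffAt]
  have l1 := leviLap_sq_mul_ge hr.contDiffAt h0 hlev0 hp
  have l2 := leviLap_norm_sub_conj_mul_sq_ge ha z.contDiff hc p v
  have hdz : fderiv ℂ z p v = z v := by rw [z.fderiv]
  have hdc : fderiv ℂ (fun x => (z x + b x) ^ 8) p v = 8 * (z p + b p) ^ 7 * (z v + b v) := by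
    have := ((z.hasFDerivAt (x := p)).add (b.hasFDerivAt (x := p))).pow 8
    rw [HasFDerivAt.fderiv (f := fun x => (z x + b x) ^ 8) this]
    simp
    ring
  have hGp : ‖(z p + b p) ^ 7 * s p - conj (z p) * (z p + b p) ^ 8‖ =
      ‖z p + b p‖ ^ 7 * ‖s p - conj (z p) * (z p + b p)‖ := by
    rw [← norm_pow, ← norm_mul]; congr 1; ring
  rw [hdz, hdc, hGp] at l2
  simp only [norm_mul, norm_pow, Complex.norm_ofNat] at l2
  have hvω : ‖z v + b v‖ ≤ ‖z v‖ + ‖b v‖ := norm_add_le _ _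
  have hcs : ‖s p - conj (z p) * (z p + b p)‖ ≤ ‖s p‖ + ‖z p‖ := by
    refine (norm_sub_le _ _).trans ?_
    rw [norm_mul, RCLike.norm_conj]
    have := mul_le_of_le_one_right (norm_nonneg (z p)) ha1
    linarith
  have hsq : ∀ A B : ℂ, ‖A‖ ^ 2 ≤ 2 * ‖A - B‖ ^ 2 + 2 * ‖B‖ ^ 2 := fun A B => by
    have h1 : ‖A‖ ≤ ‖A - B‖ + ‖B‖ := by simpa using norm_add_le (A - B) B
    have h2 := pow_le_pow_left₀ (norm_nonneg A) h1 2
    nlinarith [sq_nonneg (‖A - B‖ - ‖B‖)]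
  have hkt : ‖k p‖ ^ 2 ≤ 2 * r p + 2 * ‖z p‖ ^ 4 := by
    have h1 := hsq (k p) (conj (z p ^ 2))
    rw [RCLike.norm_conj, norm_pow] at h1
    nlinarith
  have hsk : ‖s p‖ ^ 4 ≤ 2 * r p + 2 * ‖k p‖ ^ 2 := by
    have h1 := hsq (s p ^ 2) (k p * (z p + b p) ^ 2)
    rw [norm_pow, norm_mul, norm_pow] at h1
    have h2 : (‖k p‖ * ‖z p + b p‖ ^ 2) ^ 2 ≤ ‖k p‖ ^ 2 := by
      refine pow_le_pow_left₀ (by positivity) ?_ 2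
      exact mul_le_of_le_one_right (norm_nonneg _) (pow_le_one₀ (norm_nonneg _) ha1)
    nlinarith
  have key := model_scalar_estimate (x := ‖z v‖) (y := ‖b v‖) (norm_nonneg (z p + b p))
    (norm_nonneg _) (norm_nonneg (s p)) (norm_nonneg (z p)) ha1 hF1 hz1 hcs hsk hkt
  have hxx : r p ^ 2 * ‖z v‖ ^ 2 ≤ r p ^ 2 * ‖v‖ ^ 2 :=
    mul_le_mul_of_nonneg_left (pow_le_pow_left₀ (norm_nonneg _) hzv 2) (sq_nonneg _)
  have hmix := mul_le_mul_of_nonneg_left hvω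
    (by positivity : 0 ≤ ‖z p + b p‖ ^ 14 * ‖s p - conj (z p) * (z p + b p)‖ * ‖z v‖)
  have hrv : 0 ≤ r p ^ 2 * ‖v‖ ^ 2 := by positivity
  have hbv : 0 ≤ ‖b v‖ ^ 2 := by positivity
  have htx : 0 ≤ ‖z p‖ ^ 2 * ‖z v‖ ^ 2 := by positivity
  have hax : 0 ≤ ‖z p + b p‖ ^ 16 * ‖z v‖ ^ 2 := by positivity
  unfold modelConst
  nlinarith

end ModelEstimate

section BeloshapkaCoffmanModel

open Filter Topology Metric

/-- The `i`-th coordinate on `ℂ^n`, extended by zero to all indices. -/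
def coordFn (n i : ℕ) : EuclideanSpace ℂ (Fin n) →L[ℂ] ℂ :=
  if h : i < n then EuclideanSpace.proj ⟨i, h⟩ else 0

theorem coordFn_apply {n i : ℕ} (h : i < n) (x : EuclideanSpace ℂ (Fin n)) :
    coordFn n i x = x ⟨i, h⟩ := by
  simp [coordFn, h]

theorem norm_coordFn_apply_le (n i : ℕ) (x : EuclideanSpace ℂ (Fin n)) :
    ‖coordFn n i x‖ ≤ ‖x‖ := by
  by_cases h : i < n
  · rw [coordFn_apply h]; exact PiLp.norm_apply_le x _
  · simp [coordFn, h]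

theorem eq_zero_of_coordFn {n : ℕ} {x : EuclideanSpace ℂ (Fin n)}
    (h : ∀ i < n, coordFn n i x = 0) : x = 0 := by
  ext i
  simpa [coordFn_apply i.2] using h i i.2

theorem contDiff_norm_sub_conj_sq {E : Type*} [NormedAddCommGroup E] [NormedSpace ℂ E]
    {m : WithTop ℕ∞} {g h : E → ℂ} (hg : ContDiff ℂ m g) (hh : ContDiff ℂ m h) :
    ContDiff ℝ m (fun x => ‖g x - conj (h x)‖ ^ 2) :=
  ((hg.restrict_scalars ℝ).sub
    ((Complex.conjCLE : ℂ →L[ℝ] ℂ).contDiff.comp (hh.restrict_scalars ℝ))).norm_sq ℝ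

variable (k : ℕ)

/-- The holomorphic form `w_{2σ-1} - i w_{2σ}`. -/
def bcFormStar (σ : ℕ) : EuclideanSpace ℂ (Fin (3 * k - 1)) →L[ℂ] ℂ :=
  coordFn _ (2 * σ - 1) - Complex.I • coordFn _ (2 * σ)

/-- The holomorphic form `w₁ + i w₂`. -/
def bcFormB : EuclideanSpace ℂ (Fin (3 * k - 1)) →L[ℂ] ℂ :=
  coordFn _ 1 + Complex.I • coordFn _ 2

/-- The holomorphic function which is real on the Beloshapka–Coffman form. -/
def bcReal (x : EuclideanSpace ℂ (Fin (3 * k - 1))) : ℂ :=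
  coordFn _ (2 * k - 1) x + coordFn _ 0 x * bcFormStar k 1 x

/-- A holomorphic function vanishing on the Beloshapka–Coffman form. -/
def bcVanish (x : EuclideanSpace ℂ (Fin (3 * k - 1))) : ℂ :=
  coordFn _ (2 * k - 1) x ^ 2 - coordFn _ (3 * k - 2) x * (coordFn _ 0 x + bcFormB k x) ^ 2

/-- A plurisubharmonic function vanishing on the Beloshapka–Coffman form. -/
def bcDefect (x : EuclideanSpace ℂ (Fin (3 * k - 1))) : ℝ :=
  ∑ τ ∈ Finset.Icc 1 (2 * k - 2), ‖coordFn _ τ x - conj (coordFn _ τ x)‖ ^ 2 +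
  (‖coordFn _ (3 * k - 2) x - conj (coordFn _ 0 x ^ 2)‖ ^ 2 +
  (∑ σ ∈ Finset.Icc 2 (k - 1),
    ‖coordFn _ (2 * k - 2 + σ) x - conj (coordFn _ 0 x * bcFormStar k σ x)‖ ^ 2 +
  (‖bcReal k x - conj (bcReal k x)‖ ^ 2 + ‖bcVanish k x - conj (0 : ℂ)‖ ^ 2)))

theorem contDiff_coordFn {m : WithTop ℕ∞} {n i : ℕ} : ContDiff ℂ m (coordFn n i) :=
  (coordFn n i).contDiff

theorem contDiff_coordFn_mul_star {m : WithTop ℕ∞} (σ : ℕ) :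
    ContDiff ℂ m (fun x => coordFn (3 * k - 1) 0 x * bcFormStar k σ x) :=
  contDiff_coordFn.mul (bcFormStar k σ).contDiff

theorem contDiff_bcReal {m : WithTop ℕ∞} : ContDiff ℂ m (bcReal k) :=
  contDiff_coordFn.add (contDiff_coordFn_mul_star k 1)

theorem contDiff_bcVanish {m : WithTop ℕ∞} : ContDiff ℂ m (bcVanish k) :=
  (contDiff_coordFn.pow 2).sub (contDiff_coordFn.mul
    ((contDiff_coordFn.add (bcFormB k).contDiff).pow 2))

theorem contDiff_bcDefect {m : WithTop ℕ∞} : ContDiff ℝ m (bcDefect k) :=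
  (ContDiff.sum fun _ _ => contDiff_norm_sub_conj_sq contDiff_coordFn contDiff_coordFn).add
  ((contDiff_norm_sub_conj_sq contDiff_coordFn (contDiff_coordFn.pow 2)).add
  ((ContDiff.sum fun _ _ =>
    contDiff_norm_sub_conj_sq contDiff_coordFn (contDiff_coordFn_mul_star k _)).add
  ((contDiff_norm_sub_conj_sq (contDiff_bcReal k) (contDiff_bcReal k)).add
    (contDiff_norm_sub_conj_sq (contDiff_bcVanish k) contDiff_const))))

theorem bcDefect_nonneg (x : EuclideanSpace ℂ (Fin (3 * k - 1))) : 0 ≤ bcDefect k x := by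
  unfold bcDefect; positivity

theorem leviLap_bcDefect (p v : EuclideanSpace ℂ (Fin (3 * k - 1))) :
    leviLap (bcDefect k) p v =
      ∑ τ ∈ Finset.Icc 1 (2 * k - 2), 8 * ‖coordFn _ τ v‖ ^ 2 +
      (4 * (‖coordFn _ (3 * k - 2) v‖ ^ 2 + ‖2 * coordFn _ 0 p * coordFn _ 0 v‖ ^ 2) +
      (∑ σ ∈ Finset.Icc 2 (k - 1), 4 * (‖coordFn _ (2 * k - 2 + σ) v‖ ^ 2 +
        ‖coordFn _ 0 p * bcFormStar k σ v + bcFormStar k σ p * coordFn _ 0 v‖ ^ 2) +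
      (8 * ‖coordFn _ (2 * k - 1) v +
        (coordFn _ 0 p * bcFormStar k 1 v + bcFormStar k 1 p * coordFn _ 0 v)‖ ^ 2 +
      4 * ‖fderiv ℂ (bcVanish k) p v‖ ^ 2))) := by
  have h1 : ∀ i, ContDiff ℝ 2 fun x => ‖coordFn (3 * k - 1) i x - conj (coordFn _ i x)‖ ^ 2 :=
    fun i => contDiff_norm_sub_conj_sq contDiff_coordFn contDiff_coordFn
  have h2 : ContDiff ℝ 2 fun x =>
      ‖coordFn (3 * k - 1) (3 * k - 2) x - conj (coordFn _ 0 x ^ 2)‖ ^ 2 :=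
    contDiff_norm_sub_conj_sq contDiff_coordFn (contDiff_coordFn.pow 2)
  have h3 : ∀ σ, ContDiff ℝ 2 fun x =>
      ‖coordFn _ (2 * k - 2 + σ) x - conj (coordFn _ 0 x * bcFormStar k σ x)‖ ^ 2 :=
    fun σ => contDiff_norm_sub_conj_sq contDiff_coordFn (contDiff_coordFn_mul_star k _)
  have h4 : ContDiff ℝ 2 fun x => ‖bcReal k x - conj (bcReal k x)‖ ^ 2 :=
    contDiff_norm_sub_conj_sq (contDiff_bcReal k) (contDiff_bcReal k)
  have h5 : ContDiff ℝ 2 fun x => ‖bcVanish k x - conj (0 : ℂ)‖ ^ 2 :=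
    contDiff_norm_sub_conj_sq (contDiff_bcVanish k) contDiff_const
  have hco : ∀ i, fderiv ℂ (coordFn (3 * k - 1) i) p v = coordFn _ i v := fun i => by
    rw [(coordFn (3 * k - 1) i).fderiv]
  have hstar : ∀ σ, HasFDerivAt (fun x => coordFn (3 * k - 1) 0 x * bcFormStar k σ x)
      (coordFn (3 * k - 1) 0 p • bcFormStar k σ + bcFormStar k σ p • coordFn (3 * k - 1) 0) p :=
    fun σ => (coordFn (3 * k - 1) 0).hasFDerivAt.mul (bcFormStar k σ).hasFDerivAt
  have hsq : fderiv ℂ (fun x => coordFn (3 * k - 1) 0 x ^ 2) p v =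
      2 * coordFn _ 0 p * coordFn _ 0 v := by
    have := ((coordFn (3 * k - 1) 0).hasFDerivAt (x := p)).pow 2
    rw [HasFDerivAt.fderiv (f := fun x => coordFn (3 * k - 1) 0 x ^ 2) this]
    simp
  have hre : fderiv ℂ (bcReal k) p v = coordFn _ (2 * k - 1) v +
        (coordFn _ 0 p * bcFormStar k 1 v + bcFormStar k 1 p * coordFn _ 0 v) := by
    have := ((coordFn (3 * k - 1) (2 * k - 1)).hasFDerivAt (x := p)).add (hstar 1)
    rw [HasFDerivAt.fderiv (f := bcReal k) this]
    simp
  unfold bcDefect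
  rw [leviLap_add (ContDiff.sum fun i _ => h1 i).contDiffAt (h2.add ((ContDiff.sum
      fun i _ => h3 i).add (h4.add h5))).contDiffAt,
    leviLap_add h2.contDiffAt ((ContDiff.sum fun i _ => h3 i).add (h4.add h5)).contDiffAt,
    leviLap_add (ContDiff.sum fun i _ => h3 i).contDiffAt (h4.add h5).contDiffAt,
    leviLap_add h4.contDiffAt h5.contDiffAt,
    leviLap_sum _ (fun i _ => (h1 i).contDiffAt), leviLap_sum _ (fun i _ => (h3 i).contDiffAt)]
  congr 1
  · refine Finset.sum_congr rfl fun i _ => ?_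
    rw [leviLap_norm_sub_conj_sq contDiff_coordFn contDiff_coordFn, hco]
    ring
  congr 1
  · rw [leviLap_norm_sub_conj_sq contDiff_coordFn (contDiff_coordFn.pow 2), hco, hsq]
  congr 1
  · refine Finset.sum_congr rfl fun σ _ => ?_
    rw [leviLap_norm_sub_conj_sq contDiff_coordFn (contDiff_coordFn_mul_star k _), hco,
      (hstar σ).fderiv]
    simp
  congr 1
  · rw [leviLap_norm_sub_conj_sq (contDiff_bcReal k) (contDiff_bcReal k), hre]
    ring
  · rw [leviLap_norm_sub_conj_sq (contDiff_bcVanish k) contDiff_const]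
    simp

end BeloshapkaCoffmanModel

section BeloshapkaCoffmanModelFunction

open Filter Topology Metric

theorem bcDefect_eq_zero_iff (k : ℕ) (x : EuclideanSpace ℂ (Fin (3 * k - 1))) :
    bcDefect k x = 0 ↔
      (∀ τ, 1 ≤ τ → τ ≤ 2 * k - 2 → conj (coordFn _ τ x) = coordFn _ τ x) ∧
      coordFn _ (3 * k - 2) x = conj (coordFn _ 0 x ^ 2) ∧
      (∀ σ, 2 ≤ σ → σ ≤ k - 1 →
        coordFn _ (2 * k - 2 + σ) x = conj (coordFn _ 0 x * bcFormStar k σ x)) ∧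
      conj (bcReal k x) = bcReal k x ∧ bcVanish k x = 0 := by
  unfold bcDefect
  rw [add_eq_zero_iff_of_nonneg (by positivity) (by positivity),
    add_eq_zero_iff_of_nonneg (by positivity) (by positivity),
    add_eq_zero_iff_of_nonneg (by positivity) (by positivity),
    add_eq_zero_iff_of_nonneg (by positivity) (by positivity),
    Finset.sum_eq_zero_iff_of_nonneg (fun _ _ => by positivity),
    Finset.sum_eq_zero_iff_of_nonneg (fun _ _ => by positivity)]
  simp only [Finset.mem_Icc, and_imp, pow_eq_zero_iff (two_ne_zero), norm_eq_zero, sub_eq_zero,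
    map_zero]
  constructor
  · rintro ⟨h1, h2, h3, h4, h5⟩
    exact ⟨fun τ a b => (h1 τ a b).symm, h2, h3, h4.symm, h5⟩
  · rintro ⟨h1, h2, h3, h4, h5⟩
    exact ⟨fun τ a b => (h1 τ a b).symm, h2, h3, h4.symm, h5⟩

/-- A local plurisubharmonic defining function of the Beloshapka–Coffman form. -/
def bcModel (k : ℕ) (x : EuclideanSpace ℂ (Fin (3 * k - 1))) : ℝ :=
  modelConst * (bcDefect k x + bcDefect k x * bcDefect k x * (1 + ‖x‖ ^ 2)) +
    ‖(coordFn _ 0 x + bcFormB k x) ^ 7 * coordFn _ (2 * k - 1) x -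
      conj (coordFn _ 0 x) * (coordFn _ 0 x + bcFormB k x) ^ 8‖ ^ 2

theorem modelConst_pos : 0 < modelConst := by unfold modelConst; positivity

theorem bcModel_nonneg (k : ℕ) (x : EuclideanSpace ℂ (Fin (3 * k - 1))) : 0 ≤ bcModel k x := by
  have := bcDefect_nonneg k x
  have := modelConst_pos
  unfold bcModel; positivity

theorem contDiff_bcModel (k : ℕ) : ContDiff ℝ (⊤ : ℕ∞) (bcModel k) := by
  have hω : ContDiff ℂ (⊤ : ℕ∞) (fun x => coordFn _ 0 x + bcFormB k x) :=
    contDiff_coordFn.add (bcFormB k).contDiff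
  refine (contDiff_const.mul ((contDiff_bcDefect k).add
    (((contDiff_bcDefect k).mul (contDiff_bcDefect k)).mul
      (contDiff_const.add (contDiff_norm_sq ℝ))))).add (ContDiff.norm_sq ℝ ?_)
  refine (((hω.pow 7).mul contDiff_coordFn).restrict_scalars ℝ).sub
    (ContDiff.mul ?_ ((hω.pow 8).restrict_scalars ℝ))
  exact (Complex.conjCLE : ℂ →L[ℝ] ℂ).contDiff.comp
    ((contDiff_coordFn (n := 3 * k - 1) (i := 0)).restrict_scalars ℝ)

theorem bcModel_eq_zero_iff' (k : ℕ) (x : EuclideanSpace ℂ (Fin (3 * k - 1))) :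
    bcModel k x = 0 ↔ bcDefect k x = 0 ∧
      coordFn _ (2 * k - 1) x = conj (coordFn _ 0 x) * (coordFn _ 0 x + bcFormB k x) := by
  have h0 := bcDefect_nonneg k x
  have h1 := modelConst_pos
  unfold bcModel
  rw [add_eq_zero_iff_of_nonneg (by positivity) (by positivity), mul_eq_zero_iff_left h1.ne',
    add_eq_zero_iff_of_nonneg (by positivity) (by positivity), pow_eq_zero_iff two_ne_zero,
    norm_eq_zero]
  constructor
  · rintro ⟨⟨h, -⟩, hG⟩
    refine ⟨h, ?_⟩
    have hG' : (coordFn _ 0 x + bcFormB k x) ^ 7 * (coordFn _ (2 * k - 1) x -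
        conj (coordFn _ 0 x) * (coordFn _ 0 x + bcFormB k x)) = 0 := by
      rw [← hG]; ring
    rcases mul_eq_zero.1 hG' with h2 | h2
    · have h3 : coordFn _ 0 x + bcFormB k x = 0 := by simpa using h2
      have h4 := ((bcDefect_eq_zero_iff k x).1 h).2.2.2.2
      unfold bcVanish at h4
      rw [h3] at h4 ⊢
      simpa using h4
    · exact sub_eq_zero.1 h2
  · rintro ⟨h, hF⟩
    refine ⟨⟨h, by rw [h]; ring⟩, ?_⟩
    rw [hF]; ring

theorem bcModel_eq_zero_iff (k : ℕ) (hk : 1 < k) (x : EuclideanSpace ℂ (Fin (3 * k - 1))) :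
    bcModel k x = 0 ↔ x ∈ bcForm k hk := by
  have conj_iff : ∀ c : ℂ, conj c = c ↔ c.im = 0 := fun c => Complex.conj_eq_iff_im
  have re_of : ∀ c : ℂ, c.im = 0 → ((c.re : ℝ) : ℂ) = c := fun c h =>
    Complex.conj_eq_iff_re.1 ((conj_iff c).2 h)
  rw [bcModel_eq_zero_iff', bcDefect_eq_zero_iff]
  simp only [bcForm, Set.mem_ofPred_eq]
  have key : (∀ τ, 1 ≤ τ → τ ≤ 2 * k - 2 → conj (coordFn _ τ x) = coordFn _ τ x) ↔
      ∀ τ : ℕ, ∀ _h1 : 1 ≤ τ, ∀ _h2 : τ ≤ 2*k-2, (x ⟨τ, by omega⟩).im = 0 := by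
    refine forall_congr' fun τ => forall_congr' fun h1 => forall_congr' fun h2 => ?_
    rw [coordFn_apply (by omega), conj_iff]
  rw [key]
  have hw : (∀ τ : ℕ, ∀ _h1 : 1 ≤ τ, ∀ _h2 : τ ≤ 2*k-2, (x ⟨τ, by omega⟩).im = 0) →
      ∀ τ (h1 : 1 ≤ τ) (h2 : τ ≤ 2 * k - 2),
        (((x ⟨τ, by omega⟩).re : ℝ) : ℂ) = coordFn (3 * k - 1) τ x ∧
          conj (coordFn (3 * k - 1) τ x) = coordFn (3 * k - 1) τ x := fun h τ h1 h2 => by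
    rw [coordFn_apply (by omega)]
    exact ⟨re_of _ (h τ h1 h2), (conj_iff _).2 (h τ h1 h2)⟩
  rw [← coordFn_apply (n := 3 * k - 1) (i := 0) (by omega),
    ← coordFn_apply (n := 3 * k - 1) (i := 2 * k - 1) (by omega),
    ← coordFn_apply (n := 3 * k - 1) (i := 3 * k - 2) (by omega)]
  have hnorm : ((Complex.normSq (coordFn (3 * k - 1) 0 x) : ℝ) : ℂ) =
    conj (coordFn (3 * k - 1) 0 x) * coordFn (3 * k - 1) 0 x := Complex.normSq_eq_conj_mul_self
  rw [hnorm]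
  constructor
  · rintro ⟨⟨hA, hB, hC, hD, hP⟩, hF⟩
    have hw' := hw hA
    refine ⟨hA, ?_, fun σ h1 h2 => ?_, ?_⟩
    · rw [(hw' 1 (by omega) (by omega)).1, (hw' 2 (by omega) (by omega)).1, hF]
      simp [bcFormB]; ring
    · have := hC σ h1 h2
      rw [← coordFn_apply (n := 3 * k - 1) (i := 2 * k - 2 + σ) (by omega), this,
        ← coordFn_apply (n := 3 * k - 1) (i := 0) (by omega), (hw' (2 * σ - 1) (by omega) (by omega)).1, (hw' (2 * σ) (by omega) (by omega)).1]
      simp only [bcFormStar, sub_apply, smul_apply, smul_eq_mul, map_mul, map_sub,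
        Complex.conj_I, (hw' (2 * σ - 1) (by omega) (by omega)).2,
        (hw' (2 * σ) (by omega) (by omega)).2]
      ring
    · rw [hB, map_pow]
  · rintro ⟨hA, hF, hC, hB⟩
    have hw' := hw hA
    rw [(hw' 1 (by omega) (by omega)).1, (hw' 2 (by omega) (by omega)).1] at hF
    have hF' : coordFn _ (2 * k - 1) x =
        conj (coordFn _ 0 x) * (coordFn _ 0 x + bcFormB k x) := by
      rw [hF]; simp [bcFormB]; ring
    refine ⟨⟨hA, by rw [hB, map_pow], fun σ h1 h2 => ?_, ?_, ?_⟩, hF'⟩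
    · have := hC σ h1 h2
      rw [← coordFn_apply (n := 3 * k - 1) (i := 2 * k - 2 + σ) (by omega),
        ← coordFn_apply (n := 3 * k - 1) (i := 0) (by omega), (hw' (2 * σ - 1) (by omega) (by omega)).1, (hw' (2 * σ) (by omega) (by omega)).1] at this
      rw [this]
      simp only [bcFormStar, sub_apply, smul_apply, smul_eq_mul, map_mul, map_sub,
        Complex.conj_I, (hw' (2 * σ - 1) (by omega) (by omega)).2,
        (hw' (2 * σ) (by omega) (by omega)).2]
      ring
    · unfold bcReal
      rw [hF]
      simp only [bcFormStar, sub_apply, smul_apply, smul_eq_mul, map_mul, map_sub, map_add,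
        Complex.conj_I, Complex.conj_conj, mul_one, Nat.reduceSub,
        (hw' 1 (by omega) (by omega)).2, (hw' 2 (by omega) (by omega)).2]
      ring
    · unfold bcVanish
      rw [hF', hB]; ring

theorem eq_zero_of_bc_coords {k : ℕ} (hk : 1 < k) {x : EuclideanSpace ℂ (Fin (3 * k - 1))}
    (hz : coordFn _ 0 x = 0) (hw : ∀ τ, 1 ≤ τ → τ ≤ 2 * k - 2 → coordFn _ τ x = 0)
    (hs : coordFn _ (2 * k - 1) x = 0)
    (hσ : ∀ σ, 2 ≤ σ → σ ≤ k - 1 → coordFn _ (2 * k - 2 + σ) x = 0)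
    (hlast : coordFn _ (3 * k - 2) x = 0) : x = 0 := by
  refine eq_zero_of_coordFn fun i hi => ?_
  rcases Nat.eq_zero_or_pos i with rfl | h0
  · exact hz
  by_cases h1 : i ≤ 2 * k - 2
  · exact hw i h0 h1
  by_cases h2 : i = 2 * k - 1
  · rw [h2]; exact hs
  by_cases h3 : i = 3 * k - 2
  · rw [h3]; exact hlast
  have := hσ (i - (2 * k - 2)) (by omega) (by omega)
  rwa [Nat.add_sub_cancel' (by omega)] at this

theorem leviLap_bcDefect_ge {k : ℕ} (hk : 1 < k) (p v : EuclideanSpace ℂ (Fin (3 * k - 1))) :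
    4 * ‖bcFormB k v‖ ^ 2 + 16 * (‖coordFn _ 0 p‖ ^ 2 * ‖coordFn _ 0 v‖ ^ 2) ≤
      leviLap (bcDefect k) p v := by
  rw [leviLap_bcDefect]
  have h1 : 8 * ‖coordFn (3 * k - 1) 1 v‖ ^ 2 + 8 * ‖coordFn (3 * k - 1) 2 v‖ ^ 2 ≤
      ∑ τ ∈ Finset.Icc 1 (2 * k - 2), 8 * ‖coordFn (3 * k - 1) τ v‖ ^ 2 := by
    rw [← Finset.sum_pair (f := fun τ => 8 * ‖coordFn (3 * k - 1) τ v‖ ^ 2)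
      (by norm_num : (1 : ℕ) ≠ 2)]
    refine Finset.sum_le_sum_of_subset_of_nonneg ?_ fun _ _ _ => by positivity
    intro i hi
    simp only [Finset.mem_insert, Finset.mem_singleton] at hi
    rw [Finset.mem_Icc]; omega
  have h2 : ‖bcFormB k v‖ ≤ ‖coordFn (3 * k - 1) 1 v‖ + ‖coordFn (3 * k - 1) 2 v‖ := by
    refine (norm_add_le _ _).trans ?_
    simp
  have h3 := pow_le_pow_left₀ (norm_nonneg _) h2 2
  have h4 : 0 ≤ ∑ σ ∈ Finset.Icc 2 (k - 1), 4 * (‖coordFn _ (2 * k - 2 + σ) v‖ ^ 2 +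
        ‖coordFn _ 0 p * bcFormStar k σ v + bcFormStar k σ p * coordFn _ 0 v‖ ^ 2) :=
    Finset.sum_nonneg fun _ _ => by positivity
  have h5 : 0 ≤ (8 * ‖coordFn _ (2 * k - 1) v +
        (coordFn _ 0 p * bcFormStar k 1 v + bcFormStar k 1 p * coordFn _ 0 v)‖ ^ 2 +
      4 * ‖fderiv ℂ (bcVanish k) p v‖ ^ 2) := by positivity
  have h6 : 0 ≤ ‖coordFn (3 * k - 1) (3 * k - 2) v‖ ^ 2 := by positivity
  rw [norm_mul, norm_mul, Complex.norm_ofNat, mul_pow, mul_pow]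
  nlinarith [sq_nonneg (‖coordFn (3 * k - 1) 1 v‖ - ‖coordFn (3 * k - 1) 2 v‖)]

theorem eventually_leviLap_bcModel_ge {k : ℕ} (hk : 1 < k) :
    ∀ᶠ p in 𝓝 (0 : EuclideanSpace ℂ (Fin (3 * k - 1))), ∀ v,
      leviLap (bcDefect k) p v + bcDefect k p ^ 2 * ‖v‖ ^ 2 +
        ‖coordFn _ 0 p + bcFormB k p‖ ^ 16 * ‖coordFn _ 0 v‖ ^ 2 ≤ leviLap (bcModel k) p v := by
  have ev : ∀ {f : EuclideanSpace ℂ (Fin (3 * k - 1)) → ℂ}, Continuous f → f 0 = 0 →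
      ∀ᶠ p in 𝓝 0, ‖f p‖ ≤ 1 := fun hf h0 => by
    have := hf.norm.tendsto 0
    rw [h0, norm_zero] at this
    exact this.eventually (Iic_mem_nhds one_pos)
  have hc0 : Continuous (coordFn (3 * k - 1) 0) := (coordFn _ 0).continuous
  have hcs : Continuous (coordFn (3 * k - 1) (2 * k - 1)) := (coordFn _ _).continuous
  have hcb : Continuous (bcFormB k) := (bcFormB k).continuous
  have hz := ev hc0 (map_zero _)
  have hω := ev (hc0.add hcb) (by simp)
  have hF := ev (f := fun p => coordFn _ (2 * k - 1) p -
      conj (coordFn _ 0 p) * (coordFn _ 0 p + bcFormB k p))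
    (hcs.sub ((Complex.continuous_conj.comp hc0).mul (hc0.add hcb))) (by simp)
  filter_upwards [closedBall_mem_nhds (0 : EuclideanSpace ℂ (Fin (3 * k - 1)))
    (by norm_num : (0 : ℝ) < 1 / 4), hz, hω, hF] with p hp hz hω hF v
  have hB : ‖coordFn (3 * k - 1) (3 * k - 2) p - conj (coordFn _ 0 p ^ 2)‖ ^ 2 ≤ bcDefect k p := by
    unfold bcDefect
    refine le_add_of_nonneg_of_le (by positivity) (le_add_of_nonneg_right (by positivity))
  have hP : ‖bcVanish k p‖ ^ 2 ≤ bcDefect k p := by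
    unfold bcDefect
    rw [map_zero, sub_zero]
    refine le_add_of_nonneg_of_le (by positivity) (le_add_of_nonneg_of_le (by positivity)
      (le_add_of_nonneg_of_le (by positivity) (le_add_of_nonneg_left (by positivity))))
  exact leviLap_model_ge (coordFn _ 0) (bcFormB k) (coordFn _ (2 * k - 1)) (coordFn _ (3 * k - 2))
    (contDiff_bcDefect k) (bcDefect_nonneg k p) (leviLap_bcDefect_ge hk p v) hP hB
    (by simpa using hp) hz hω hF (norm_coordFn_apply_le _ _ _)

theorem eq_zero_of_leviLap_bcDefect {k : ℕ} (hk : 1 < k)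
    {p v : EuclideanSpace ℂ (Fin (3 * k - 1))} (hv : v ≠ 0)
    (hr : bcDefect k p = 0) (hlev : leviLap (bcDefect k) p v = 0)
    (hω : ‖coordFn _ 0 p + bcFormB k p‖ ^ 16 * ‖coordFn _ 0 v‖ ^ 2 = 0) : p = 0 := by
  rw [leviLap_bcDefect, add_eq_zero_iff_of_nonneg (by positivity) (by positivity),
    add_eq_zero_iff_of_nonneg (by positivity) (by positivity),
    add_eq_zero_iff_of_nonneg (by positivity) (by positivity),
    add_eq_zero_iff_of_nonneg (by positivity) (by positivity),
    Finset.sum_eq_zero_iff_of_nonneg (fun _ _ => by positivity),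
    Finset.sum_eq_zero_iff_of_nonneg (fun _ _ => by positivity)] at hlev
  obtain ⟨hA, hB, hC, hD, -⟩ := hlev
  have hA' : ∀ τ, 1 ≤ τ → τ ≤ 2 * k - 2 → coordFn _ τ v = 0 := fun τ h1 h2 => by
    simpa using hA τ (Finset.mem_Icc.2 ⟨h1, h2⟩)
  rw [mul_eq_zero_iff_left four_ne_zero,
    add_eq_zero_iff_of_nonneg (by positivity) (by positivity)] at hB
  have hlast : coordFn _ (3 * k - 2) v = 0 := by simpa using hB.1
  have hstar : ∀ σ, 1 ≤ σ → σ ≤ k - 1 → bcFormStar k σ v = 0 := fun σ h1 h2 => by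
    simp [bcFormStar, hA' (2 * σ - 1) (by omega) (by omega), hA' (2 * σ) (by omega) (by omega)]
  have hC' : ∀ σ, 2 ≤ σ → σ ≤ k - 1 → coordFn _ (2 * k - 2 + σ) v = 0 ∧
      bcFormStar k σ p * coordFn _ 0 v = 0 := fun σ h1 h2 => by
    have := hC σ (Finset.mem_Icc.2 ⟨h1, h2⟩)
    rw [mul_eq_zero_iff_left four_ne_zero,
      add_eq_zero_iff_of_nonneg (by positivity) (by positivity), hstar σ (by omega) h2] at this
    simpa using this
  have hvz : coordFn _ 0 v ≠ 0 := fun hz => hv <| by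
    refine eq_zero_of_bc_coords hk hz hA' ?_ (fun σ h1 h2 => (hC' σ h1 h2).1) hlast
    rw [hstar 1 le_rfl (by omega), hz] at hD
    simpa using hD
  have hz : coordFn _ 0 p = 0 := by simpa [hvz] using hB.2
  have hb : bcFormB k p = 0 := by simpa [hvz, hz] using hω
  obtain ⟨rA, rB, rC, -, rP⟩ := (bcDefect_eq_zero_iff k p).1 hr
  have real_zero : ∀ a b c : ℂ, conj a = a → conj b = b → (c = Complex.I ∨ c = -Complex.I) →
      a + c * b = 0 → a = 0 ∧ b = 0 := by
    intro a b c ha hb' hc h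
    have h' : a - c * b = 0 := by
      have := congrArg conj h
      rcases hc with rfl | rfl <;>
        simpa [ha, hb', sub_eq_add_neg] using this
    have ha0 : a = 0 := by linear_combination (h + h') / 2
    have hc0 : c ≠ 0 := by rcases hc with rfl | rfl <;> simp
    rw [ha0, zero_add] at h
    exact ⟨ha0, (mul_eq_zero.1 h).resolve_left hc0⟩
  have hpair : ∀ σ, 1 ≤ σ → σ ≤ k - 1 →
      coordFn (3 * k - 1) (2 * σ - 1) p = 0 ∧ coordFn (3 * k - 1) (2 * σ) p = 0 := by
    intro σ h1 h2
    rcases eq_or_lt_of_le h1 with rfl | h1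
    · exact real_zero _ _ Complex.I (rA 1 (by omega) (by omega)) (rA 2 (by omega) (by omega))
        (Or.inl rfl) hb
    · have h3 : bcFormStar k σ p = 0 := by simpa [hvz] using (hC' σ h1 h2).2
      refine real_zero _ _ (-Complex.I) (rA _ (by omega) (by omega)) (rA _ (by omega) (by omega))
        (Or.inr rfl) ?_
      simpa [bcFormStar, sub_eq_add_neg] using h3
  refine eq_zero_of_bc_coords hk hz (fun τ h1 h2 => ?_) ?_ (fun σ h1 h2 => ?_) ?_
  · rcases Nat.even_or_odd' τ with ⟨m, rfl | rfl⟩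
    · exact (hpair m (by omega) (by omega)).2
    · exact (hpair (m + 1) (by omega) (by omega)).1
  · simpa [bcVanish, hz, hb] using rP
  · rw [rC σ h1 h2, hz]; simp
  · rw [rB, hz]; simp

theorem eventually_leviLap_bcModel {k : ℕ} (hk : 1 < k) :
    ∀ᶠ p in 𝓝 (0 : EuclideanSpace ℂ (Fin (3 * k - 1))),
      (∀ v, 0 ≤ leviLap (bcModel k) p v) ∧
        (p ≠ 0 → ∀ v, v ≠ 0 → 0 < leviLap (bcModel k) p v) := by
  filter_upwards [eventually_leviLap_bcModel_ge hk] with p hp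
  have h1 : ∀ v, 0 ≤ leviLap (bcDefect k) p v := fun v =>
    le_trans (by positivity) (leviLap_bcDefect_ge hk p v)
  have h2 : ∀ v : EuclideanSpace ℂ (Fin (3 * k - 1)), 0 ≤ bcDefect k p ^ 2 * ‖v‖ ^ 2 :=
    fun v => by positivity
  have h3 : ∀ v : EuclideanSpace ℂ (Fin (3 * k - 1)),
      0 ≤ ‖coordFn _ 0 p + bcFormB k p‖ ^ 16 * ‖coordFn _ 0 v‖ ^ 2 :=
    fun v => by positivity
  have h4 : ∀ v, 0 ≤ leviLap (bcModel k) p v := fun v => by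
    linarith [hp v, h1 v, h2 v, h3 v]
  refine ⟨h4, fun hp0 v hv => (h4 v).lt_of_ne fun hz => hp0 ?_⟩
  have hv' : ‖v‖ ≠ 0 := norm_ne_zero_iff.2 hv
  have e2 : bcDefect k p ^ 2 * ‖v‖ ^ 2 = 0 := by linarith [hp v, h1 v, h2 v, h3 v]
  exact eq_zero_of_leviLap_bcDefect hk hv (by simpa [hv] using e2)
    (by linarith [hp v, h1 v, h2 v, h3 v]) (by linarith [hp v, h1 v, h2 v, h3 v])

end BeloshapkaCoffmanModelFunction

section CRSingularity

open Filter Topology Metric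

/-- `ρ` is a smooth plurisubharmonic defining function of `M` on the open set `U`, strictly
plurisubharmonic off `S`. -/
structure IsLocalPshDefining {n : ℕ} (M S U : Set (EuclideanSpace ℂ (Fin n)))
    (ρ : EuclideanSpace ℂ (Fin n) → ℝ) : Prop where
  isOpen : IsOpen U
  contDiffAt : ∀ x ∈ U, ContDiffAt ℝ (⊤ : ℕ∞) ρ x
  nonneg : ∀ x ∈ U, 0 ≤ ρ x
  eq_zero_iff : ∀ x ∈ U, ρ x = 0 ↔ x ∈ M
  leviLap_nonneg : ∀ x ∈ U, ∀ v, 0 ≤ leviLap ρ x v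
  leviLap_pos : ∀ x ∈ U, x ∉ S → ∀ v, v ≠ 0 → 0 < leviLap ρ x v

theorem exists_isLocalPshDefining_of_crSingularity {k : ℕ} (hk : 1 < k)
    {M S : Set (EuclideanSpace ℂ (Fin (3 * k - 1)))} {s : EuclideanSpace ℂ (Fin (3 * k - 1))}
    (hs : s ∈ S) (h : IsGenericCRSingularity k hk M s) :
    ∃ U ρ, s ∈ U ∧ IsLocalPshDefining M S U ρ := by
  obtain ⟨U, V, Φ, Ψ, hU, hV, hsU, h0V, hΦ, hΨ, hmΦ, hmΨ, hΨΦ, hΦΨ, hΦs, himg⟩ := h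
  obtain ⟨N, hN, hNo, h0N⟩ := _root_.eventually_nhds_iff.1 (eventually_leviLap_bcModel hk)
  have htwo : ∀ y, ContDiffAt ℝ 2 (bcModel k) y := fun y =>
    (contDiff_bcModel k).contDiffAt.of_le (by norm_cast)
  have hΦt : ∀ x ∈ U, ContDiffAt ℝ (⊤ : ℕ∞) Φ x := fun x hx =>
    contDiffAt_real_of_holomorphic hU hΦ hx
  have hlev : ∀ x ∈ U, ∀ v, leviLap (fun y => bcModel k (Φ y)) x v =
      leviLap (bcModel k) (Φ x) (fderiv ℝ Φ x v) := fun x hx v => by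
    refine leviLap_comp_holomorphic (htwo _)
      ((hΦt x hx).of_le (by norm_cast)) ?_ v
    filter_upwards [hU.mem_nhds hx] with y hy
    exact hΦ.differentiableAt (hU.mem_nhds hy)
  have hinj : ∀ x ∈ U, ∀ v, v ≠ 0 → fderiv ℝ Φ x v ≠ 0 := fun x hx v hv hzero => by
    have h1 : HasFDerivAt Φ (fderiv ℝ Φ x) x :=
      ((hΦt x hx).differentiableAt (by simp)).hasFDerivAt
    have h2 : HasFDerivAt Ψ (fderiv ℝ Ψ (Φ x)) (Φ x) :=
      ((contDiffAt_real_of_holomorphic hV hΨ (hmΦ hx)).differentiableAt (by simp)).hasFDerivAt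
    have h3 := h2.comp x h1
    have h4 : Ψ ∘ Φ =ᶠ[𝓝 x] id := by
      filter_upwards [hU.mem_nhds hx] with y hy using hΨΦ y hy
    have h5 := (h3.congr_of_eventuallyEq h4.symm).unique (hasFDerivAt_id x)
    have h6 := DFunLike.congr_fun h5 v
    rw [ContinuousLinearMap.comp_apply, hzero, map_zero] at h6
    exact hv h6.symm
  have hxs : ∀ x ∈ U, x ≠ s → Φ x ≠ 0 := fun x hx hne h0 =>
    hne (by rw [← hΨΦ x hx, h0, ← hΦs, hΨΦ s hsU])
  refine ⟨U ∩ Φ ⁻¹' N, fun y => bcModel k (Φ y), ⟨hsU, ?_⟩, ?_⟩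
  · simpa [hΦs] using h0N
  constructor
  · exact hΦ.continuousOn.isOpen_inter_preimage hU hNo
  · rintro x ⟨hx, -⟩
    exact (contDiff_bcModel k).contDiffAt.comp x (hΦt x hx)
  · exact fun x _ => bcModel_nonneg k _
  · rintro x ⟨hx, -⟩
    rw [bcModel_eq_zero_iff k hk]
    constructor
    · intro hxb
      have : Φ x ∈ Φ '' (M ∩ U) := himg ▸ ⟨hxb, hmΦ hx⟩
      obtain ⟨y, ⟨hyM, hyU⟩, hxy⟩ := this
      rwa [← hΨΦ x hx, ← hxy, hΨΦ y hyU]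
    · intro hxM
      have : Φ x ∈ bcForm k hk ∩ V := himg ▸ ⟨x, ⟨hxM, hx⟩, rfl⟩
      exact this.1
  · rintro x ⟨hx, hxN⟩ v
    rw [hlev x hx]
    exact (hN _ hxN).1 _
  · rintro x ⟨hx, hxN⟩ hxS v hv
    rw [hlev x hx]
    exact (hN _ hxN).2 (hxs x hx fun e => hxS (e ▸ hs)) _ (hinj x hx v hv)

end CRSingularity

section FlatConvexFunction

open Filter Topology

/-- A smooth convex function vanishing exactly on the nonpositive half-line. -/
def flatConvex (t : ℝ) : ℝ := ∫ s in (0 : ℝ)..t, Real.smoothTransition s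

theorem hasDerivAt_flatConvex (t : ℝ) : HasDerivAt flatConvex (Real.smoothTransition t) t :=
  intervalIntegral.integral_hasDerivAt_right
    (Real.smoothTransition.continuous.intervalIntegrable _ _)
    (Real.smoothTransition.continuous.stronglyMeasurableAtFilter _ _)
    Real.smoothTransition.continuous.continuousAt

theorem deriv_flatConvex : deriv flatConvex = Real.smoothTransition :=
  funext fun t => (hasDerivAt_flatConvex t).deriv

theorem contDiff_flatConvex : ContDiff ℝ (⊤ : ℕ∞) flatConvex := by
  rw [contDiff_infty_iff_deriv, deriv_flatConvex]
  exact ⟨fun t => (hasDerivAt_flatConvex t).differentiableAt, Real.smoothTransition.contDiff⟩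

theorem flatConvex_of_nonpos {t : ℝ} (ht : t ≤ 0) : flatConvex t = 0 := by
  unfold flatConvex
  rw [intervalIntegral.integral_symm, intervalIntegral.integral_congr (g := fun _ => 0)]
  · simp
  · intro s hs
    rw [Set.uIcc_of_le ht] at hs
    exact Real.smoothTransition.zero_of_nonpos hs.2

theorem flatConvex_pos {t : ℝ} (ht : 0 < t) : 0 < flatConvex t :=
  intervalIntegral.intervalIntegral_pos_of_pos_on
    (Real.smoothTransition.continuous.intervalIntegrable _ _)
    (fun _ hs => Real.smoothTransition.pos_of_pos hs.1) ht

theorem flatConvex_nonneg (t : ℝ) : 0 ≤ flatConvex t := by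
  rcases le_or_gt t 0 with h | h
  · rw [flatConvex_of_nonpos h]
  · exact (flatConvex_pos h).le

theorem flatConvex_eq_zero_iff {t : ℝ} : flatConvex t = 0 ↔ t ≤ 0 :=
  ⟨fun h => not_lt.1 fun ht => (flatConvex_pos ht).ne' h, flatConvex_of_nonpos⟩

theorem deriv_deriv_flatConvex_nonneg (t : ℝ) : 0 ≤ deriv (deriv flatConvex) t := by
  rw [deriv_flatConvex]
  exact Real.smoothTransition.monotone.deriv_nonneg

theorem leviLap_flatConvex_comp_ge {E : Type*} [NormedAddCommGroup E] [NormedSpace ℂ E]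
    {f : E → ℝ} {p : E} (hf : ContDiffAt ℝ 2 f p) (v : E) :
    Real.smoothTransition (f p) * leviLap f p v ≤ leviLap (fun x => flatConvex (f x)) p v := by
  rw [leviLap_comp_real (contDiff_flatConvex.contDiffAt.of_le (by norm_cast)) hf,
    deriv_flatConvex]
  have := deriv_deriv_flatConvex_nonneg (f p)
  rw [deriv_flatConvex] at this
  have h2 : 0 ≤ fderiv ℝ f p v ^ 2 + fderiv ℝ f p (Complex.I • v) ^ 2 := by positivity
  nlinarith [mul_nonneg this h2]

end FlatConvexFunction

section TotallyReal

open Filter Topology Metric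

/-- An immersed patch can be straightened: it is the slice `y = 0` of a local diffeomorphism. -/
theorem exists_straightening_of_injective_fderiv {X E : Type*} [NormedAddCommGroup X]
    [NormedSpace ℝ X] [FiniteDimensional ℝ X] [NormedAddCommGroup E] [NormedSpace ℝ E]
    [FiniteDimensional ℝ E] {f : X → E} {V : Set X} (hV : IsOpen V)
    (hf : ContDiffOn ℝ (⊤ : ℕ∞) f V) {x₀ : X} (hx₀ : x₀ ∈ V)
    (hinj : Function.Injective (fderiv ℝ f x₀)) :
    ∃ (m : ℕ) (e : OpenPartialHomeomorph (X × EuclideanSpace ℝ (Fin m)) E),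
      (x₀, 0) ∈ e.source ∧ e.source ⊆ Prod.fst ⁻¹' V ∧ (∀ x, e (x, 0) = f x) ∧
      (∀ q ∈ e.target, ContDiffAt ℝ (⊤ : ℕ∞) e.symm q) ∧
      ∀ v, (fderiv ℝ e.symm (f x₀) v).2 = 0 → v ∈ (fderiv ℝ f x₀).range := by
  have := FiniteDimensional.complete ℝ X
  have := FiniteDimensional.complete ℝ E
  obtain ⟨N, hN⟩ := Submodule.exists_isCompl ((fderiv ℝ f x₀).range)
  let ι : EuclideanSpace ℝ (Fin (Module.finrank ℝ N)) →L[ℝ] E :=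
    N.subtypeL ∘L ((toEuclidean (E := N)).symm : EuclideanSpace ℝ (Fin (Module.finrank ℝ N)) →L[ℝ] N)
  let L : X × EuclideanSpace ℝ (Fin (Module.finrank ℝ N)) →L[ℝ] E := (fderiv ℝ f x₀).coprod ι
  have hιN : ∀ y, ι y ∈ N := fun y => ((toEuclidean (E := N)).symm y).2
  have hι0 : ∀ y, ι y = 0 → y = 0 := fun y hy =>
    (toEuclidean (E := N)).symm.map_eq_zero_iff.1 (Subtype.ext hy)
  have hbij : Function.Bijective L := by
    constructor
    · rw [injective_iff_map_eq_zero]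
      rintro ⟨x, y⟩ hxy
      have hxy' : fderiv ℝ f x₀ x + ι y = 0 := hxy
      have h1 : fderiv ℝ f x₀ x ∈ (fderiv ℝ f x₀).range := ⟨x, rfl⟩
      have h2 : fderiv ℝ f x₀ x ∈ N := by
        rw [eq_neg_of_add_eq_zero_left hxy']; exact N.neg_mem (hιN y)
      have h3 : fderiv ℝ f x₀ x = 0 := Submodule.disjoint_def.1 hN.disjoint _ h1 h2
      rw [h3, zero_add] at hxy'
      exact Prod.ext ((injective_iff_map_eq_zero _).1 hinj _ h3) (hι0 y hxy')
    · intro v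
      have hv : v ∈ (fderiv ℝ f x₀).range ⊔ N := by rw [hN.sup_eq_top]; trivial
      obtain ⟨_, ⟨x, rfl⟩, z, hz, rfl⟩ := Submodule.mem_sup.1 hv
      refine ⟨(x, toEuclidean (⟨z, hz⟩ : N)), ?_⟩
      change fderiv ℝ f x₀ x + (((toEuclidean (E := N)).symm (toEuclidean (⟨z, hz⟩ : N)) : N) : E) = _
      rw [ContinuousLinearEquiv.symm_apply_apply]
      rfl
  let A : (X × EuclideanSpace ℝ (Fin (Module.finrank ℝ N))) ≃L[ℝ] E :=
    (LinearEquiv.ofBijective L.toLinearMap hbij).toContinuousLinearEquiv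
  have hAL : (A : X × EuclideanSpace ℝ (Fin (Module.finrank ℝ N)) →L[ℝ] E) = L := by
    exact ContinuousLinearMap.ext fun v => rfl
  let F : X × EuclideanSpace ℝ (Fin (Module.finrank ℝ N)) → E := fun z => f z.1 + ι z.2
  have hFs : ∀ z, z.1 ∈ V → ContDiffAt ℝ (⊤ : ℕ∞) F z := fun z hz =>
    ((hf.contDiffAt (hV.mem_nhds hz)).comp z contDiffAt_fst).add
      (ι.contDiff.contDiffAt.comp z contDiffAt_snd)
  have hF0 : HasFDerivAt F (A : _ →L[ℝ] E) (x₀, 0) := by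
    rw [hAL]
    have h1 : HasFDerivAt f (fderiv ℝ f x₀) x₀ :=
      ((hf.contDiffAt (hV.mem_nhds hx₀)).differentiableAt (by simp)).hasFDerivAt
    have h2 := (HasFDerivAt.comp (x₀, (0 : EuclideanSpace ℝ (Fin (Module.finrank ℝ N)))) (f := Prod.fst)
      h1 hasFDerivAt_fst).add
      (ι.hasFDerivAt.comp (x₀, (0 : EuclideanSpace ℝ (Fin (Module.finrank ℝ N)))) hasFDerivAt_snd)
    refine h2.congr_fderiv ?_
    exact ContinuousLinearMap.ext fun v => rfl
  have hFc := hFs (x₀, 0) hx₀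
  let e₀ := hFc.toOpenPartialHomeomorph F hF0 (by simp)
  have hinv : ∀ᶠ z in 𝓝 (x₀, (0 : EuclideanSpace ℝ (Fin (Module.finrank ℝ N)))),
      fderiv ℝ F z ∈ Set.range ((↑) : ((X × EuclideanSpace ℝ (Fin (Module.finrank ℝ N))) ≃L[ℝ] E) → _) := by
    have hc : ContinuousAt (fderiv ℝ F) (x₀, 0) :=
      (hFc.fderiv_right (m := 0) (by norm_cast)).continuousAt
    apply hc
    rw [hF0.fderiv]
    exact ContinuousLinearEquiv.nhds A
  have hV' : ∀ᶠ z in 𝓝 (x₀, (0 : EuclideanSpace ℝ (Fin (Module.finrank ℝ N)))), z.1 ∈ V :=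
    continuousAt_fst.eventually (hV.mem_nhds hx₀)
  obtain ⟨O, hO, hOo, h0O⟩ := _root_.eventually_nhds_iff.1 (hinv.and hV')
  refine ⟨_, e₀.restrOpen O hOo, ?_, ?_, ?_, ?_, ?_⟩
  · exact ⟨hFc.mem_toOpenPartialHomeomorph_source hF0 (by simp), h0O⟩
  · exact fun z hz => (hO z hz.2).2
  · intro x
    change f x + ι 0 = f x
    simp
  · intro q hq
    have hz : (e₀.restrOpen O hOo).symm q ∈ O := ((e₀.restrOpen O hOo).map_target hq).2
    obtain ⟨B, hB⟩ := (hO _ hz).1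
    have hsm := hFs _ (hO _ hz).2
    refine (e₀.restrOpen O hOo).contDiffAt_symm (f₀' := B) hq ?_ hsm
    rw [hB]
    exact (hsm.differentiableAt (by simp)).hasFDerivAt
  · intro v hv
    have hs : (x₀, (0 : EuclideanSpace ℝ (Fin (Module.finrank ℝ N)))) ∈ e₀.source :=
      hFc.mem_toOpenPartialHomeomorph_source hF0 (by simp)
    have hq : f x₀ = e₀ (x₀, 0) := by
      change f x₀ = f x₀ + ι 0
      simp
    have hd : HasFDerivAt e₀.symm (A.symm : E →L[ℝ] _) (f x₀) := by
      refine e₀.hasFDerivAt_symm ?_ ?_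
      · rw [hq]; exact e₀.map_source hs
      · rw [hq, e₀.left_inv hs]; exact hF0
    have hd' : fderiv ℝ (e₀.restrOpen O hOo).symm (f x₀) = (A.symm : E →L[ℝ] _) := hd.fderiv
    rw [hd'] at hv
    have : v = A (A.symm v) := (A.apply_symm_apply v).symm
    rw [this]
    have h2 : A (A.symm v) = fderiv ℝ f x₀ (A.symm v).1 + ι (A.symm v).2 := rfl
    rw [h2]
    change (A.symm v).2 = 0 at hv
    rw [hv, map_zero, add_zero]
    exact ⟨_, rfl⟩

theorem convex_halfSpace (d : ℕ) (hd : 0 < d) : Convex ℝ (halfSpace d hd) := by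
  intro x hx y hy a b ha hb _
  simp only [halfSpace, Set.mem_ofPred_eq] at *
  simp only [PiLp.add_apply, PiLp.smul_apply, smul_eq_mul]
  positivity

theorem nonempty_interior_halfSpace (d : ℕ) (hd : 0 < d) : (interior (halfSpace d hd)).Nonempty := by
  have ho : IsOpen {x : EuclideanSpace ℝ (Fin d) | 0 < x ⟨0, hd⟩} :=
    isOpen_lt continuous_const (by fun_prop)
  refine ⟨EuclideanSpace.single ⟨0, hd⟩ 1, interior_maximal (fun x hx => ?_) ho ?_⟩
  · exact le_of_lt (show 0 < x ⟨0, hd⟩ from hx)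
  · simp

/-- A parametrized patch of `M` contributes the whole range of its differential to the tangent
space of `M`, at boundary points as well. -/
theorem range_fderiv_le_tangentSpaceAt {n d : ℕ} (hd : 0 < d) {M : Set (EuclideanSpace ℂ (Fin n))}
    {V : Set (EuclideanSpace ℝ (Fin d))} {f : EuclideanSpace ℝ (Fin d) → EuclideanSpace ℂ (Fin n)}
    (hV : IsOpen V) {x₀ : EuclideanSpace ℝ (Fin d)} (hx₀ : x₀ ∈ V ∩ halfSpace d hd)
    (hf : DifferentiableAt ℝ f x₀) (hM : f '' (V ∩ halfSpace d hd) ⊆ M) :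
    (fderiv ℝ f x₀).range ≤ tangentSpaceAt M (f x₀) := by
  have hu : UniqueDiffWithinAt ℝ (V ∩ halfSpace d hd) x₀ := by
    rw [Set.inter_comm]
    exact ((uniqueDiffOn_convex (convex_halfSpace d hd)
      (nonempty_interior_halfSpace d hd)) x₀ hx₀.2).inter (hV.mem_nhds hx₀.1)
  have hspan : Submodule.span ℝ (tangentConeAt ℝ (V ∩ halfSpace d hd) x₀) = ⊤ := by
    have h1 := hu.dense_tangentConeAt
    have h2 := Submodule.dense_iff_topologicalClosure_eq_top.1 h1
    rwa [(Submodule.closed_of_finiteDimensional _).submodule_topologicalClosure_eq] at h2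
  have hmap := hf.hasFDerivAt.hasFDerivWithinAt (s := V ∩ halfSpace d hd) |>.mapsTo_tangent_cone
  rintro _ ⟨x, rfl⟩
  have hx : x ∈ Submodule.span ℝ (tangentConeAt ℝ (V ∩ halfSpace d hd) x₀) := by
    rw [hspan]; trivial
  have := Submodule.mem_map_of_mem (f := (fderiv ℝ f x₀).toLinearMap) hx
  rw [Submodule.map_span] at this
  refine Submodule.span_mono ?_ this
  rintro _ ⟨y, hy, rfl⟩
  exact tangentConeAt_mono hM (hmap hy)

theorem exists_isLocalPshDefining_of_totallyReal {n d : ℕ} (hd : 0 < d)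
    {M S : Set (EuclideanSpace ℂ (Fin n))} (hM : IsSubmanifold d hd M)
    {p : EuclideanSpace ℂ (Fin n)} (hp : p ∈ M) (hT : TotallyRealAt M p) :
    ∃ U ρ, p ∈ U ∧ IsLocalPshDefining M S U ρ := by
  obtain ⟨V, U, f, hV, hU, hpU, hf, -, hfi, himg, hrel⟩ := hM p hp
  obtain ⟨x₀, hx₀, rfl⟩ : p ∈ f '' (V ∩ halfSpace d hd) := himg ▸ ⟨hp, hpU⟩
  obtain ⟨m, e, hes, heV, hef, hesm, hker⟩ :=
    exists_straightening_of_injective_fderiv hV hf hx₀.1 (hfi x₀ hx₀.1)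
  have hWo : IsOpen {x | (x, (0 : EuclideanSpace ℝ (Fin m))) ∈ e.source} :=
    e.open_source.preimage (by fun_prop)
  obtain ⟨U', hU', hMU'⟩ := hrel _ hWo fun x hx => heV hx
  have hptgt : f x₀ ∈ e.target := by rw [← hef]; exact e.map_source hes
  have hpsymm : e.symm (f x₀) = (x₀, 0) := by rw [← hef, e.left_inv hes]
  have hpU' : f x₀ ∈ U' := (hMU' ▸ ⟨x₀, ⟨hes, hx₀.2⟩, rfl⟩ : f x₀ ∈ M ∩ U').2
  let Y : EuclideanSpace ℂ (Fin n) → EuclideanSpace ℝ (Fin m) := fun q => (e.symm q).2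
  let t : EuclideanSpace ℂ (Fin n) → ℝ := fun q => -((e.symm q).1 ⟨0, hd⟩)
  let ρ : EuclideanSpace ℂ (Fin n) → ℝ := fun q => ‖Y q‖ ^ 2 + flatConvex (t q)
  have hY : ∀ q ∈ e.target, ContDiffAt ℝ (⊤ : ℕ∞) Y q := fun q hq => (hesm q hq).snd
  have ht : ∀ q ∈ e.target, ContDiffAt ℝ (⊤ : ℕ∞) t q := fun q hq =>
    (((EuclideanSpace.proj (𝕜 := ℝ) (⟨0, hd⟩ : Fin d)).contDiff.contDiffAt).comp q
      (hesm q hq).fst).neg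
  have hYn : ∀ q ∈ e.target, ContDiffAt ℝ (⊤ : ℕ∞) (fun q => ‖Y q‖ ^ 2) q := fun q hq =>
    (hY q hq).norm_sq ℝ
  have htf : ∀ q ∈ e.target, ContDiffAt ℝ (⊤ : ℕ∞) (fun q => flatConvex (t q)) q := fun q hq =>
    contDiff_flatConvex.contDiffAt.comp q (ht q hq)
  have hρ : ∀ q ∈ e.target, ContDiffAt ℝ (⊤ : ℕ∞) ρ q := fun q hq => (hYn q hq).add (htf q hq)
  have hpos : ∀ v, v ≠ 0 → 0 < leviLap ρ (f x₀) v := by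
    intro v hv
    have htwo : (2 : WithTop ℕ∞) ≤ ((⊤ : ℕ∞) : WithTop ℕ∞) := by norm_cast
    have hadd : leviLap ρ (f x₀) v = leviLap (fun q => ‖Y q‖ ^ 2) (f x₀) v +
        leviLap (fun q => flatConvex (t q)) (f x₀) v :=
      leviLap_add ((hYn _ hptgt).of_le htwo) ((htf _ hptgt).of_le htwo) v
    have h0 : t (f x₀) ≤ 0 := by
      have : 0 ≤ x₀ ⟨0, hd⟩ := hx₀.2
      simp only [t, hpsymm]
      linarith
    have h1 := leviLap_flatConvex_comp_ge ((ht _ hptgt).of_le htwo) v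
    rw [Real.smoothTransition.zero_of_nonpos h0, zero_mul] at h1
    have hY0 : Y (f x₀) = 0 := by simp only [Y, hpsymm]
    rw [hadd, leviLap_norm_sq ((hY _ hptgt).of_le htwo), hY0, inner_zero_left]
    have hDY : ∀ w, fderiv ℝ Y (f x₀) w = (fderiv ℝ e.symm (f x₀) w).2 := fun w => by
      have h := ((hesm _ hptgt).differentiableAt (by simp)).hasFDerivAt.snd
      rw [show fderiv ℝ Y (f x₀) = _ from h.fderiv]
      rfl
    have hle := range_fderiv_le_tangentSpaceAt hd hV hx₀
      ((hf.contDiffAt (hV.mem_nhds hx₀.1)).differentiableAt (by simp))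
      (himg.trans_subset Set.inter_subset_left)
    have hne : ¬ (fderiv ℝ Y (f x₀) v = 0 ∧ fderiv ℝ Y (f x₀) (Complex.I • v) = 0) := by
      rintro ⟨ha, hb⟩
      rw [hDY] at ha hb
      exact hv (hT v (hle (hker v ha)) (hle (hker _ hb)))
    have : 0 < ‖fderiv ℝ Y (f x₀) v‖ ^ 2 + ‖fderiv ℝ Y (f x₀) (Complex.I • v)‖ ^ 2 := by
      by_cases ha : fderiv ℝ Y (f x₀) v = 0
      · have hb : fderiv ℝ Y (f x₀) (Complex.I • v) ≠ 0 := fun hb => hne ⟨ha, hb⟩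
        positivity
      · positivity
    linarith
  obtain ⟨O, hO, hOo, hpO⟩ := _root_.eventually_nhds_iff.1
    (eventually_leviLap_pos ((hρ _ hptgt).of_le (by norm_cast)) hpos)
  refine ⟨e.target ∩ U' ∩ O, ρ, ⟨⟨hptgt, hpU'⟩, hpO⟩, ?_⟩
  constructor
  · exact (e.open_target.inter hU').inter hOo
  · exact fun x hx => hρ x hx.1.1
  · exact fun x _ => add_nonneg (sq_nonneg _) (flatConvex_nonneg _)
  · rintro x ⟨⟨hx, hxU'⟩, -⟩
    have key : ρ x = 0 ↔ Y x = 0 ∧ t x ≤ 0 := by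
      rw [← flatConvex_eq_zero_iff, ← norm_eq_zero (a := Y x), ← sq_eq_zero_iff (a := ‖Y x‖)]
      exact add_eq_zero_iff_of_nonneg (sq_nonneg _) (flatConvex_nonneg _)
    rw [key]
    constructor
    · rintro ⟨h1, h2⟩
      have hmem := e.map_target hx
      have heq : e.symm x = ((e.symm x).1, 0) := Prod.ext rfl h1
      have hx' : f (e.symm x).1 = x := by
        rw [← hef, ← heq, e.right_inv hx]
      rw [heq] at hmem
      have : x ∈ M ∩ U' := hMU' ▸ ⟨(e.symm x).1, ⟨hmem, by simpa [t, halfSpace] using h2⟩, hx'⟩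
      exact this.1
    · intro hxM
      have : x ∈ M ∩ U' := ⟨hxM, hxU'⟩
      rw [← hMU'] at this
      obtain ⟨y, ⟨hyW, hyH⟩, rfl⟩ := this
      have hsy : e.symm (f y) = (y, 0) := by rw [← hef, e.left_inv hyW]
      have : 0 ≤ y ⟨0, hd⟩ := hyH
      simp only [Y, t, hsy]
      exact ⟨trivial, by linarith⟩
  · intro x hx v
    by_cases hv : v = 0
    · simp [hv, leviLap]
    · exact (hO x hx.2 v hv).le
  · exact fun x hx _ v hv => hO x hx.2 v hv

end TotallyReal

section PolynomialConvexity

open Filter Topology Metric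

variable {n : ℕ}

/-- `g` is a smooth nonnegative plurisubharmonic function on `ℂ^n` vanishing on `M`. -/
structure IsPshVanishingOn (M : Set (EuclideanSpace ℂ (Fin n)))
    (g : EuclideanSpace ℂ (Fin n) → ℝ) : Prop where
  contDiff : ContDiff ℝ (⊤ : ℕ∞) g
  nonneg : ∀ x, 0 ≤ g x
  eq_zero : ∀ x ∈ M, g x = 0
  leviLap_nonneg : ∀ x v, 0 ≤ leviLap g x v

theorem IsPshVanishingOn.sum {M : Set (EuclideanSpace ℂ (Fin n))} {ι : Type*} {s : Finset ι}
    {g : ι → EuclideanSpace ℂ (Fin n) → ℝ} (hg : ∀ i ∈ s, IsPshVanishingOn M (g i)) :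
    IsPshVanishingOn M (fun x => ∑ i ∈ s, g i x) where
  contDiff := ContDiff.sum fun i hi => (hg i hi).contDiff
  nonneg x := Finset.sum_nonneg fun i hi => (hg i hi).nonneg x
  eq_zero x hx := Finset.sum_eq_zero fun i hi => (hg i hi).eq_zero x hx
  leviLap_nonneg x v := by
    rw [leviLap_sum s fun i hi => (hg i hi).contDiff.contDiffAt.of_le (by norm_cast)]
    exact Finset.sum_nonneg fun i hi => (hg i hi).leviLap_nonneg x v

/-- Truncating a strictly plurisubharmonic function that is at most `c` on `M`. -/
theorem isPshVanishingOn_flatConvex {M : Set (EuclideanSpace ℂ (Fin n))}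
    {u : EuclideanSpace ℂ (Fin n) → ℝ} (hu : ContDiff ℝ (⊤ : ℕ∞) u)
    (hpos : ∀ x v, v ≠ 0 → 0 < leviLap u x v) {c : ℝ} (hM : ∀ x ∈ M, u x ≤ c) :
    IsPshVanishingOn M (fun x => flatConvex (u x - c)) ∧
      ∀ x, c < u x → 0 < flatConvex (u x - c) ∧
        ∀ v, v ≠ 0 → 0 < leviLap (fun x => flatConvex (u x - c)) x v := by
  have hu2 : ∀ x, ContDiffAt ℝ 2 u x := fun x => hu.contDiffAt.of_le (by norm_cast)
  have hge : ∀ x v, Real.smoothTransition (u x - c) * leviLap u x v ≤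
      leviLap (fun x => flatConvex (u x - c)) x v := fun x v => by
    have h := leviLap_flatConvex_comp_ge ((hu2 x).sub (contDiffAt_const (c := c))) v
    have h2 : leviLap (fun x => u x - c) x v = leviLap u x v := by
      simpa [sub_eq_add_neg, leviLap_const] using
        leviLap_add (hu2 x) (contDiffAt_const (c := -c)) v
    change _ * leviLap (fun x => u x - c) x v ≤ _ at h
    rwa [h2] at h
  refine ⟨⟨contDiff_flatConvex.comp (hu.sub contDiff_const), fun x => flatConvex_nonneg _,
    fun x hx => flatConvex_of_nonpos (by linarith [hM x hx]), fun x v => ?_⟩, fun x hx => ?_⟩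
  · by_cases hv : v = 0
    · simp [hv, leviLap]
    · exact (mul_nonneg (Real.smoothTransition.nonneg _) (hpos x v hv).le).trans (hge x v)
  · have hx' : 0 < u x - c := sub_pos.2 hx
    exact ⟨flatConvex_pos hx', fun v hv =>
      (mul_pos (Real.smoothTransition.pos_of_pos hx') (hpos x v hv)).trans_le (hge x v)⟩

theorem contDiff_evalPoly (P : MvPolynomial (Fin n) ℂ) {m : WithTop ℕ∞} :
    ContDiff ℂ m (evalPoly P) := by
  induction P using MvPolynomial.induction_on with
  | C a =>
    have : evalPoly (n := n) (MvPolynomial.C a) = fun _ => a := by funext z; simp [evalPoly]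
    rw [this]; exact contDiff_const
  | add p q hp hq =>
    have : evalPoly (p + q) = fun z => evalPoly p z + evalPoly q z := by
      funext z; simp [evalPoly]
    rw [this]; exact hp.add hq
  | mul_X p i hp =>
    have : evalPoly (p * MvPolynomial.X i) = fun z => evalPoly p z * z i := by
      funext z; simp [evalPoly]
    rw [this]; exact hp.mul (EuclideanSpace.proj (𝕜 := ℂ) i).contDiff

theorem exists_evalPoly_separating {M : Set (EuclideanSpace ℂ (Fin n))} (hM : IsCompact M)
    (hpc : IsPolyConvex M) {x : EuclideanSpace ℂ (Fin n)} (hx : x ∉ M) :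
    ∃ (P : MvPolynomial (Fin n) ℂ) (r : ℝ), (∀ w ∈ M, ‖evalPoly P w‖ ≤ r) ∧
      0 ≤ r ∧ r < ‖evalPoly P x‖ := by
  rw [← hpc] at hx
  simp only [polyHull, Set.mem_ofPred_eq, not_forall, not_le] at hx
  obtain ⟨P, hP⟩ := hx
  have hc : Continuous (evalPoly P) := (contDiff_evalPoly P (m := 0)).continuous
  obtain ⟨C, hC⟩ := hM.exists_bound_of_continuousOn hc.continuousOn
  have hval : ∀ w ∈ M, (⨆ _ : w ∈ M, ‖evalPoly P w‖) = ‖evalPoly P w‖ := fun w hw => by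
    have : Nonempty (w ∈ M) := ⟨hw⟩
    exact ciSup_const
  have hval0 : ∀ w ∉ M, (⨆ _ : w ∈ M, ‖evalPoly P w‖) = 0 := fun w hw => by
    have : IsEmpty (w ∈ M) := ⟨hw⟩
    exact Real.iSup_of_isEmpty _
  have hb : BddAbove (Set.range fun w => ⨆ _ : w ∈ M, ‖evalPoly P w‖) := by
    refine ⟨max C 0, ?_⟩
    rintro _ ⟨w, rfl⟩
    by_cases hw : w ∈ M
    · simp only [hval w hw]; exact (hC w hw).trans (le_max_left _ _)
    · simp only [hval0 w hw]; exact le_max_right _ _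
  refine ⟨P, _, fun w hw => ?_, ?_, hP⟩
  · have := le_ciSup hb w
    simpa only [hval w hw] using this
  · exact Real.iSup_nonneg fun w => Real.iSup_nonneg fun _ => norm_nonneg _

theorem leviLap_normSq_add_norm_sq_pos {g : EuclideanSpace ℂ (Fin n) → ℂ} (hg : ContDiff ℂ 2 g)
    {ε : ℝ} (hε : 0 < ε) (x v : EuclideanSpace ℂ (Fin n)) (hv : v ≠ 0) :
    0 < leviLap (fun z => ‖g z‖ ^ 2 + ε * ‖z‖ ^ 2) x v := by
  have hn2 : ContDiffAt ℝ 2 (fun z : EuclideanSpace ℂ (Fin n) => ‖z‖ ^ 2) x :=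
    contDiffAt_id.norm_sq ℝ
  have h := leviLap_norm_sub_conj_sq hg (contDiff_const (c := (0 : ℂ))) x v
  simp only [map_zero, sub_zero] at h
  have hv' : 0 < ‖v‖ := norm_pos_iff.2 hv
  rw [leviLap_add ((hg.restrict_scalars ℝ).contDiffAt.norm_sq ℝ) (contDiffAt_const.mul hn2), h,
    leviLap_const_mul ε hn2, leviLap_norm_sq_self]
  positivity

/-- Points off a polynomially convex compact set are seen by a global plurisubharmonic function
vanishing on it. -/
theorem exists_isPshVanishingOn_of_notMem {M : Set (EuclideanSpace ℂ (Fin n))} (hM : IsCompact M)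
    (hpc : IsPolyConvex M) {x : EuclideanSpace ℂ (Fin n)} (hx : x ∉ M) :
    ∃ (g : EuclideanSpace ℂ (Fin n) → ℝ) (O : Set (EuclideanSpace ℂ (Fin n))),
      IsPshVanishingOn M g ∧ IsOpen O ∧ x ∈ O ∧
      ∀ y ∈ O, 0 < g y ∧ ∀ v, v ≠ 0 → 0 < leviLap g y v := by
  obtain ⟨P, r, hr, hr0, hrx⟩ := exists_evalPoly_separating hM hpc hx
  obtain ⟨R, hR⟩ := hM.exists_bound_of_continuousOn
    (f := fun z : EuclideanSpace ℂ (Fin n) => z) continuousOn_id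
  have hgap : 0 < ‖evalPoly P x‖ ^ 2 - r ^ 2 := by nlinarith
  set c := ‖evalPoly P x‖ ^ 2 with hc
  obtain ⟨ε, hε, hεR⟩ : ∃ ε : ℝ, 0 < ε ∧ ε * R ^ 2 ≤ (c - r ^ 2) / 2 := by
    refine ⟨(c - r ^ 2) / 2 / (R ^ 2 + 1), by positivity, ?_⟩
    rw [div_mul_eq_mul_div, div_le_iff₀ (by positivity)]
    nlinarith
  let u : EuclideanSpace ℂ (Fin n) → ℝ := fun z => ‖evalPoly P z‖ ^ 2 + ε * ‖z‖ ^ 2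
  have hu : ContDiff ℝ (⊤ : ℕ∞) u :=
    (((contDiff_evalPoly P).restrict_scalars ℝ).norm_sq ℝ).add
      (contDiff_const.mul (contDiff_id.norm_sq ℝ))
  have huM : ∀ w ∈ M, u w ≤ r ^ 2 + (c - r ^ 2) / 2 := fun w hw => by
    have h1 : ‖evalPoly P w‖ ^ 2 ≤ r ^ 2 := pow_le_pow_left₀ (norm_nonneg _) (hr w hw) 2
    have h2 : ‖w‖ ^ 2 ≤ R ^ 2 := pow_le_pow_left₀ (norm_nonneg _) (hR w hw) 2
    have h3 := mul_le_mul_of_nonneg_left h2 hε.le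
    simp only [u]
    linarith
  obtain ⟨h1, h2⟩ := isPshVanishingOn_flatConvex hu
    (fun x v hv => leviLap_normSq_add_norm_sq_pos (contDiff_evalPoly P) hε x v hv) huM
  refine ⟨_, {y | r ^ 2 + (c - r ^ 2) / 2 < u y}, h1,
    isOpen_lt continuous_const hu.continuous, ?_, fun y hy => h2 y hy⟩
  have : 0 ≤ ε * ‖x‖ ^ 2 := by positivity
  change r ^ 2 + (c - r ^ 2) / 2 < c + ε * ‖x‖ ^ 2
  linarith

theorem exists_isPshVanishingOn_of_isPolyConvex {M W : Set (EuclideanSpace ℂ (Fin n))}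
    (hM : IsCompact M) (hpc : IsPolyConvex M) (hW : IsOpen W) (hMW : M ⊆ W) :
    ∃ g, IsPshVanishingOn M g ∧ ∀ y ∉ W, 0 < g y ∧ ∀ v, v ≠ 0 → 0 < leviLap g y v := by
  classical
  obtain ⟨R, hR0, hR⟩ : ∃ R : ℝ, 0 ≤ R ∧ ∀ x ∈ M, ‖x‖ ≤ R := by
    obtain ⟨R, hR⟩ := hM.exists_bound_of_continuousOn
      (f := fun z : EuclideanSpace ℂ (Fin n) => z) continuousOn_id
    exact ⟨max R 0, le_max_right _ _, fun x hx => (hR x hx).trans (le_max_left _ _)⟩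
  have hne : ∀ x : {x // x ∉ M}, _ := fun x => exists_isPshVanishingOn_of_notMem hM hpc x.2
  choose g O hg hO hxO hpos using hne
  have hK : IsCompact (closedBall (0 : EuclideanSpace ℂ (Fin n)) R \ W) :=
    (isCompact_closedBall _ _).diff hW
  obtain ⟨t, ht⟩ := hK.elim_finite_subcover O hO fun x hx =>
    Set.mem_iUnion.2 ⟨⟨x, fun h => hx.2 (hMW h)⟩, hxO _⟩
  have hfar := isPshVanishingOn_flatConvex (M := M) (c := R ^ 2)
    (u := fun z : EuclideanSpace ℂ (Fin n) => ‖z‖ ^ 2) (contDiff_id.norm_sq ℝ)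
    (fun x v hv => by
      have : 0 < ‖v‖ := norm_pos_iff.2 hv
      rw [leviLap_norm_sq_self]; positivity)
    (fun x hx => pow_le_pow_left₀ (norm_nonneg _) (hR x hx) 2)
  let G : Option {x // x ∉ M} → EuclideanSpace ℂ (Fin n) → ℝ := fun o =>
    o.elim (fun x => flatConvex (‖x‖ ^ 2 - R ^ 2)) g
  have hG : ∀ i, IsPshVanishingOn M (G i)
    | none => hfar.1
    | some x => hg x
  refine ⟨fun x => ∑ i ∈ Finset.insertNone t, G i x, .sum fun i _ => hG i, fun y hy => ?_⟩
  obtain ⟨i, hi, hi1, hi2⟩ : ∃ i ∈ Finset.insertNone t, 0 < G i y ∧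
      ∀ v, v ≠ 0 → 0 < leviLap (G i) y v := by
    by_cases hyR : ‖y‖ ≤ R
    · have hyK : y ∈ closedBall (0 : EuclideanSpace ℂ (Fin n)) R \ W := ⟨by simpa using hyR, hy⟩
      obtain ⟨x, hx, hyx⟩ := Set.mem_iUnion₂.1 (ht hyK)
      exact ⟨some x, by simpa using hx, hpos x y hyx⟩
    · refine ⟨none, by simp, hfar.2 y ?_⟩
      exact pow_lt_pow_left₀ (not_le.1 hyR) hR0 two_ne_zero
  refine ⟨Finset.sum_pos' (fun j _ => (hG j).nonneg y) ⟨i, hi, hi1⟩, fun v hv => ?_⟩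
  rw [leviLap_sum _ fun j _ => (hG j).contDiff.contDiffAt.of_le (by norm_cast)]
  exact Finset.sum_pos' (fun j _ => (hG j).leviLap_nonneg y v) ⟨i, hi, hi2 v hv⟩

end PolynomialConvexity

section Gluing

open Filter Topology Metric

variable {n : ℕ}

theorem leviLap_eq_zero_of_notMem_tsupport {E : Type*} [NormedAddCommGroup E] [NormedSpace ℂ E]
    {f : E → ℝ} {x : E} (hx : x ∉ tsupport f) (v : E) : leviLap f x v = 0 := by
  rw [(notMem_tsupport_iff_eventuallyEq.1 hx).leviLap_eq v]
  exact leviLap_const 0 x v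

theorem leviLap_mul_of_isLocalMin {E : Type*} [NormedAddCommGroup E] [NormedSpace ℂ E]
    {ψ ρ : E → ℝ} {x : E} (hψ : ContDiffAt ℝ 2 ψ x) (hρ : ContDiffAt ℝ 2 ρ x)
    (h0 : ρ x = 0) (hmin : IsLocalMin ρ x) (v : E) :
    leviLap (fun y => ψ y * ρ y) x v = ψ x * leviLap ρ x v := by
  rw [leviLap_mul hψ hρ, h0, hmin.fderiv_eq_zero]
  simp

namespace IsLocalPshDefining

variable {M S U : Set (EuclideanSpace ℂ (Fin n))} {ρ ψ : EuclideanSpace ℂ (Fin n) → ℝ}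

theorem contDiff_mul (h : IsLocalPshDefining M S U ρ) (hψ : ContDiff ℝ (⊤ : ℕ∞) ψ)
    (hsupp : tsupport ψ ⊆ U) : ContDiff ℝ (⊤ : ℕ∞) fun x => ψ x * ρ x :=
  contDiff_iff_contDiffAt.2 fun x => by
    by_cases hx : x ∈ tsupport ψ
    · exact hψ.contDiffAt.mul (h.contDiffAt x (hsupp hx))
    · refine (contDiffAt_const (c := (0 : ℝ))).congr_of_eventuallyEq ?_
      filter_upwards [notMem_tsupport_iff_eventuallyEq.1 hx] with y hy
      rw [hy, Pi.zero_apply, zero_mul]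

theorem mul_nonneg (h : IsLocalPshDefining M S U ρ) (hψ : ∀ x, 0 ≤ ψ x)
    (hsupp : tsupport ψ ⊆ U) (x : EuclideanSpace ℂ (Fin n)) : 0 ≤ ψ x * ρ x := by
  by_cases hx : x ∈ U
  · exact _root_.mul_nonneg (hψ x) (h.nonneg x hx)
  · simp [image_eq_zero_of_notMem_tsupport fun hx' => hx (hsupp hx')]

theorem mul_eq_zero_of_mem (h : IsLocalPshDefining M S U ρ) (hsupp : tsupport ψ ⊆ U)
    {x : EuclideanSpace ℂ (Fin n)} (hx : x ∈ M) : ψ x * ρ x = 0 := by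
  by_cases hxU : x ∈ U
  · simp [(h.eq_zero_iff x hxU).2 hx]
  · simp [image_eq_zero_of_notMem_tsupport fun hx' => hxU (hsupp hx')]

theorem leviLap_mul_eq (h : IsLocalPshDefining M S U ρ) (hψ : ContDiff ℝ (⊤ : ℕ∞) ψ)
    {x : EuclideanSpace ℂ (Fin n)} (hx : x ∈ M) (hxU : x ∈ U) (v : EuclideanSpace ℂ (Fin n)) :
    leviLap (fun y => ψ y * ρ y) x v = ψ x * leviLap ρ x v := by
  have h0 := (h.eq_zero_iff x hxU).2 hx
  refine leviLap_mul_of_isLocalMin (hψ.contDiffAt.of_le (by norm_cast))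
    ((h.contDiffAt x hxU).of_le (by norm_cast)) h0 ?_ v
  filter_upwards [h.isOpen.mem_nhds hxU] with y hy
  rw [h0]
  exact h.nonneg y hy

theorem leviLap_mul_nonneg (h : IsLocalPshDefining M S U ρ) (hψ : ContDiff ℝ (⊤ : ℕ∞) ψ)
    (hψ0 : ∀ x, 0 ≤ ψ x) (hsupp : tsupport ψ ⊆ U) {x : EuclideanSpace ℂ (Fin n)} (hx : x ∈ M)
    (v : EuclideanSpace ℂ (Fin n)) : 0 ≤ leviLap (fun y => ψ y * ρ y) x v := by
  by_cases hxU : x ∈ U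
  · rw [h.leviLap_mul_eq hψ hx hxU]
    exact _root_.mul_nonneg (hψ0 x) (h.leviLap_nonneg x hxU v)
  · rw [leviLap_eq_zero_of_notMem_tsupport]
    exact fun hx' => hxU (hsupp (tsupport_mul_subset_left hx'))

end IsLocalPshDefining

/-- Local plurisubharmonic defining functions glue to one on a neighborhood of `M`. -/
theorem exists_isLocalPshDefining_nhds {M S : Set (EuclideanSpace ℂ (Fin n))} (hM : IsCompact M)
    (hS : S.Finite) (hloc : ∀ p ∈ M, ∃ U ρ, p ∈ U ∧ IsLocalPshDefining M S U ρ) :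
    ∃ σ W, ContDiff ℝ (⊤ : ℕ∞) σ ∧ (∀ x, 0 ≤ σ x) ∧ HasCompactSupport σ ∧ M ⊆ W ∧
      IsLocalPshDefining M S W σ := by
  classical
  have hloc' : ∀ p : M, ∃ U ρ, p.1 ∈ U ∧ IsLocalPshDefining M S U ρ := fun p => hloc p.1 p.2
  choose U ρ hpU hρ using hloc'
  have hbump : ∀ p : M, ∃ ψ : ContDiffBump p.1, tsupport ψ ⊆ U p ∧
      ∀ s ∈ S, s ≠ p.1 → s ∉ tsupport ψ := fun p => by
    have hopen : U p ∩ (S \ {p.1})ᶜ ∈ 𝓝 p.1 :=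
      ((hρ p).isOpen.inter (hS.subset Set.sdiff_subset).isClosed.isOpen_compl).mem_nhds
        ⟨hpU p, fun h => h.2 rfl⟩
    obtain ⟨r, hr, hball⟩ := nhds_basis_closedBall.mem_iff.1 hopen
    refine ⟨⟨r / 2, r, by positivity, by linarith⟩, ?_, fun s hs hsp hmem => ?_⟩
    · rw [ContDiffBump.tsupport_eq]
      exact fun x hx => (hball hx).1
    · rw [ContDiffBump.tsupport_eq] at hmem
      exact (hball hmem).2 ⟨hs, hsp⟩
  choose ψ hψU hψS using hbump
  have hψs : ∀ p, ContDiff ℝ (⊤ : ℕ∞) (ψ p) := fun p => (ψ p).contDiff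
  have hψ0 : ∀ p x, 0 ≤ ψ p x := fun p x => (ψ p).nonneg
  obtain ⟨t₀, ht₀⟩ := hM.elim_finite_subcover (fun p : M => ball p.1 (ψ p).rIn)
    (fun p => isOpen_ball) fun x hx => Set.mem_iUnion.2 ⟨⟨x, hx⟩, mem_ball_self (ψ _).rIn_pos⟩
  have hSfin : {p : M | p.1 ∈ S}.Finite := hS.preimage Subtype.val_injective.injOn
  let t : Finset M := t₀ ∪ hSfin.toFinset
  let σ : EuclideanSpace ℂ (Fin n) → ℝ := fun x => ∑ p ∈ t, ψ p x * ρ p x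
  let B : Set (EuclideanSpace ℂ (Fin n)) := ⋃ p ∈ t, ball p.1 (ψ p).rIn
  have hBo : IsOpen B := isOpen_biUnion fun p _ => isOpen_ball
  have hMB : M ⊆ B := fun x hx => by
    obtain ⟨p, hp, hxp⟩ := Set.mem_iUnion₂.1 (ht₀ hx)
    exact Set.mem_iUnion₂.2 ⟨p, Finset.mem_union_left _ hp, hxp⟩
  have hone : ∀ p : M, ∀ x ∈ ball p.1 (ψ p).rIn, ψ p x = 1 ∧ x ∈ U p := fun p x hx => by
    have h1 : ψ p x = 1 := (ψ p).one_of_mem_closedBall (ball_subset_closedBall hx)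
    exact ⟨h1, hψU p (subset_tsupport _ (by simp [h1]))⟩
  have hterm : ∀ p, ContDiff ℝ (⊤ : ℕ∞) fun x => ψ p x * ρ p x := fun p =>
    (hρ p).contDiff_mul (hψs p) (hψU p)
  have hσ : ContDiff ℝ (⊤ : ℕ∞) σ := ContDiff.sum fun p _ => hterm p
  have hσ0 : ∀ x, 0 ≤ σ x := fun x =>
    Finset.sum_nonneg fun p _ => (hρ p).mul_nonneg (hψ0 p) (hψU p) x
  have hσc : HasCompactSupport σ := by
    refine HasCompactSupport.intro (t.isCompact_biUnion fun p _ => (ψ p).hasCompactSupport)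
      fun x hx => Finset.sum_eq_zero fun p hp => ?_
    rw [image_eq_zero_of_notMem_tsupport fun h => hx (Set.mem_iUnion₂.2 ⟨p, hp, h⟩), zero_mul]
  have hnear : ∀ q ∈ M, ∀ᶠ x in 𝓝 q, (∀ v, 0 ≤ leviLap σ x v) ∧
      (x ∉ S → ∀ v, v ≠ 0 → 0 < leviLap σ x v) := by
    intro q hq
    by_cases hqS : q ∈ S
    · have hqt : (⟨q, hq⟩ : M) ∈ t := Finset.mem_union_right _ (by simpa using hqS)
      have heq : σ =ᶠ[𝓝 q] ρ ⟨q, hq⟩ := by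
        have h1 : ∀ᶠ x in 𝓝 q, ∀ p ∈ t, p ≠ ⟨q, hq⟩ → ψ p x = 0 := by
          rw [Filter.eventually_all_finset]
          intro p _
          by_cases hpq : p = ⟨q, hq⟩
          · simp [hpq]
          · have := notMem_tsupport_iff_eventuallyEq.1
              (hψS p q hqS fun h => hpq (Subtype.ext h.symm))
            filter_upwards [this] with x hx _ using hx
        filter_upwards [h1, (ψ ⟨q, hq⟩).eventuallyEq_one] with x hx1 hx2
        have hx2' : ψ ⟨q, hq⟩ x = 1 := hx2
        simp only [σ]
        rw [Finset.sum_eq_single_of_mem _ hqt fun p hp hpq => by rw [hx1 p hp hpq, zero_mul],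
          hx2', one_mul]
      filter_upwards [heq.eventuallyEq_nhds, (hρ ⟨q, hq⟩).isOpen.mem_nhds (hpU _)] with x hx hxU
      refine ⟨fun v => ?_, fun hxS v hv => ?_⟩ <;> rw [hx.leviLap_eq v]
      · exact (hρ ⟨q, hq⟩).leviLap_nonneg x hxU v
      · exact (hρ ⟨q, hq⟩).leviLap_pos x hxU hxS v hv
    · have hpos : ∀ v, v ≠ 0 → 0 < leviLap σ q v := fun v hv => by
        rw [leviLap_sum _ fun p _ => (hterm p).contDiffAt.of_le (by norm_cast)]
        obtain ⟨p, hp, hqp⟩ := Set.mem_iUnion₂.1 (hMB hq)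
        refine Finset.sum_pos' (fun p _ => (hρ p).leviLap_mul_nonneg (hψs p) (hψ0 p) (hψU p) hq v)
          ⟨p, hp, ?_⟩
        obtain ⟨h1, h2⟩ := hone p q hqp
        rw [(hρ p).leviLap_mul_eq (hψs p) hq h2, h1, one_mul]
        exact (hρ p).leviLap_pos q h2 hqS v hv
      filter_upwards [eventually_leviLap_pos (hσ.contDiffAt.of_le (by norm_cast)) hpos] with x hx
      refine ⟨fun v => ?_, fun _ => hx⟩
      by_cases hv : v = 0
      · simp [hv, leviLap]
      · exact (hx v hv).le
  refine ⟨σ, interior {x | (∀ v, 0 ≤ leviLap σ x v) ∧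
      (x ∉ S → ∀ v, v ≠ 0 → 0 < leviLap σ x v)} ∩ B, hσ, hσ0, hσc,
    fun q hq => ⟨mem_interior_iff_mem_nhds.2 (hnear q hq), hMB hq⟩, ?_⟩
  constructor
  · exact isOpen_interior.inter hBo
  · exact fun x _ => hσ.contDiffAt
  · exact fun x _ => hσ0 x
  · rintro x ⟨-, hxB⟩
    constructor
    · intro hx0
      obtain ⟨p, hp, hxp⟩ := Set.mem_iUnion₂.1 hxB
      obtain ⟨h1, h2⟩ := hone p x hxp
      have := (Finset.sum_eq_zero_iff_of_nonneg
        fun p _ => (hρ p).mul_nonneg (hψ0 p) (hψU p) x).1 hx0 p hp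
      rw [h1, one_mul] at this
      exact ((hρ p).eq_zero_iff x h2).1 this
    · exact fun hx => Finset.sum_eq_zero fun p _ => (hρ p).mul_eq_zero_of_mem (hψU p) hx
  · exact fun x hx => (interior_subset hx.1).1
  · exact fun x hx => (interior_subset hx.1).2

/-- On a polynomially convex compact set, local plurisubharmonic defining functions globalize. -/
theorem exists_global_psh_defining {M S : Set (EuclideanSpace ℂ (Fin n))} (hM : IsCompact M)
    (hS : S.Finite) (hpc : IsPolyConvex M)
    (hloc : ∀ p ∈ M, ∃ U ρ, p ∈ U ∧ IsLocalPshDefining M S U ρ) :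
    ∃ ρ, IsLocalPshDefining M S Set.univ ρ := by
  obtain ⟨σ, W, hσ, hσ0, hσc, hMW, hW⟩ := exists_isLocalPshDefining_nhds hM hS hloc
  obtain ⟨g, hg, hgW⟩ := exists_isPshVanishingOn_of_isPolyConvex hM hpc hW.isOpen hMW
  have hσ2 : ∀ x, ContDiffAt ℝ 2 σ x := fun x => hσ.contDiffAt.of_le (by norm_cast)
  have hg2 : ∀ x, ContDiffAt ℝ 2 g x := fun x => hg.contDiff.contDiffAt.of_le (by norm_cast)
  have hK : IsCompact ((tsupport σ \ W) ×ˢ sphere (0 : EuclideanSpace ℂ (Fin n)) 1) :=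
    (hσc.isCompact.diff hW.isOpen).prod (isCompact_sphere 0 1)
  have hne : ∀ v ∈ sphere (0 : EuclideanSpace ℂ (Fin n)) 1, v ≠ 0 := by
    rintro v hv rfl
    simp at hv
  obtain ⟨C, hC⟩ := hK.exists_bound_of_continuousOn
    (f := fun q => leviLap σ q.1 q.2 / leviLap g q.1 q.2) fun q hq =>
      ((continuousAt_leviLap (hσ2 q.1) q.2).div (continuousAt_leviLap (hg2 q.1) q.2)
        ((hgW q.1 hq.1.2).2 q.2 (hne _ hq.2)).ne').continuousWithinAt
  have hA : 0 < max C 0 + 1 := by positivity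
  set A := max C 0 + 1 with hAdef
  have hAg2 : ∀ x, ContDiffAt ℝ 2 (fun x => A * g x) x := fun x => contDiffAt_const.mul (hg2 x)
  have hlev : ∀ x v, leviLap (fun x => σ x + A * g x) x v = leviLap σ x v + A * leviLap g x v :=
    fun x v => by rw [leviLap_add (hσ2 x) (hAg2 x), leviLap_const_mul A (hg2 x)]
  have hout : ∀ x ∉ W, ∀ v, v ≠ 0 → 0 < leviLap (fun x => σ x + A * g x) x v := by
    intro x hx v hv
    by_cases hxs : x ∈ tsupport σ
    · refine leviLap_pos_of_sphere (fun w hw => ?_) hv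
      have hgp := (hgW x hx).2 w (hne w hw)
      have h1 : |leviLap σ x w / leviLap g x w| ≤ C := hC (x, w) ⟨⟨hxs, hx⟩, hw⟩
      have h2 : -A < leviLap σ x w / leviLap g x w := by
        have := (abs_le.1 h1).1
        have := le_max_left C 0
        linarith
      rw [lt_div_iff₀ hgp] at h2
      rw [hlev]
      linarith
    · rw [hlev, leviLap_eq_zero_of_notMem_tsupport hxs, zero_add]
      exact mul_pos hA ((hgW x hx).2 v hv)
  refine ⟨fun x => σ x + A * g x, isOpen_univ, ?_, ?_, ?_, ?_, ?_⟩
  · exact fun x _ => hσ.contDiffAt.add (contDiffAt_const.mul hg.contDiff.contDiffAt)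
  · exact fun x _ => add_nonneg (hσ0 x) (mul_nonneg hA.le (hg.nonneg x))
  · intro x _
    rw [add_eq_zero_iff_of_nonneg (hσ0 x) (mul_nonneg hA.le (hg.nonneg x)), mul_eq_zero,
      or_iff_right hA.ne']
    constructor
    · rintro ⟨h1, h2⟩
      have hxW : x ∈ W := by_contra fun h => (hgW x h).1.ne' h2
      exact (hW.eq_zero_iff x hxW).1 h1
    · exact fun hx => ⟨(hW.eq_zero_iff x (hMW hx)).2 hx, hg.eq_zero x hx⟩
  · intro x _ v
    by_cases hx : x ∈ W
    · rw [hlev]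
      exact add_nonneg (hW.leviLap_nonneg x hx v) (mul_nonneg hA.le (hg.leviLap_nonneg x v))
    · by_cases hv : v = 0
      · simp [hv, leviLap]
      · exact (hout x hx v hv).le
  · intro x _ hxS v hv
    by_cases hx : x ∈ W
    · rw [hlev]
      exact add_pos_of_pos_of_nonneg (hW.leviLap_pos x hx hxS v hv)
        (mul_nonneg hA.le (hg.leviLap_nonneg x v))
    · exact hout x hx v hv

end Gluing

/-- **Theorem 1.4 (3).** Let `M ⊆ ℂ^{3k-1}` (`k > 1`) be a `2k`-dimensional smooth compact
connected submanifold that is totally real except on a finite set `S` of generic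
CR-singularities. If `M` is polynomially convex, then `M = ρ⁻¹(0)` for a smooth nonnegative
function `ρ` on `ℂ^{3k-1}` that is p.s.h. everywhere and strictly p.s.h. on `ℂ^{3k-1} \ S`. -/
theorem psh_defining_function_global_of_polynomially_convex
    (k : ℕ) (hk : 1 < k)
    (M S : Set (EuclideanSpace ℂ (Fin (3*k-1))))
    (hsub : IsSubmanifold (2*k) (by omega) M)
    (hcpt : IsCompact M) (hconn : IsConnected M)
    (hS : S.Finite) (hSM : S ⊆ M)
    (htr : ∀ p ∈ M \ S, TotallyRealAt M p)
    (hcr : ∀ p ∈ S, IsGenericCRSingularity k hk M p)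
    (hpc : IsPolyConvex M) :
    ∃ ρ : EuclideanSpace ℂ (Fin (3*k-1)) → ℝ,
      ContDiff ℝ (⊤ : ℕ∞) ρ ∧ (∀ x, 0 ≤ ρ x) ∧ ρ ⁻¹' {0} = M ∧
      PshOn ρ Set.univ ∧ StrictPshOn ρ (Set.univ \ S) := by
  obtain ⟨ρ, hρ⟩ := exists_global_psh_defining hcpt hS hpc fun p hp => by
    by_cases hpS : p ∈ S
    · exact exists_isLocalPshDefining_of_crSingularity hk hpS (hcr p hpS)
    · exact exists_isLocalPshDefining_of_totallyReal _ hsub hp (htr p ⟨hp, hpS⟩)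
  have hsm : ContDiff ℝ (⊤ : ℕ∞) ρ :=
    contDiff_iff_contDiffAt.2 fun x => hρ.contDiffAt x (Set.mem_univ x)
  have hslice : ∀ x v, sliceLaplacian ρ x v = leviLap ρ x v := fun x v =>
    sliceLaplacian_eq_leviLap (hsm.contDiffAt.of_le (by norm_cast)) v
  refine ⟨ρ, hsm, fun x => hρ.nonneg x trivial, Set.ext fun x => hρ.eq_zero_iff x trivial,
    fun x _ v => ?_, fun x hx v hv => ?_⟩
  · rw [hslice]
    exact hρ.leviLap_nonneg x trivial v
  · rw [hslice]
    exact hρ.leviLap_pos x trivial hx.2 v hv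
end
end

section
/- Let K ⊆ ℂ^n be a compact polynomially convex set and let p₁, …, p_ℓ ∈ ℂ^n \ K. Then there exist r₁, …, r_ℓ > 0 such that for all choices of radii 0 < r'_j ≤ r_j (j = 1, …, ℓ), the set K ∪ ⋃_{j=1}^ℓ B̄_{p_j}(r'_j) is polynomially convex, where B̄_{p}(r) denotes the closed Euclidean ball of radius r centered at p in ℂ^n. -/
open scoped Manifold ComplexConjugate

noncomputable section

section EvalPoly

variable {n : ℕ} (P Q : MvPolynomial (Fin n) ℂ) (z : EuclideanSpace ℂ (Fin n))

lemma evalPoly_sub : evalPoly (P - Q) z = evalPoly P z - evalPoly Q z := by simp [evalPoly]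

lemma evalPoly_mul : evalPoly (P * Q) z = evalPoly P z * evalPoly Q z := by simp [evalPoly]

lemma evalPoly_pow (m : ℕ) : evalPoly (P ^ m) z = evalPoly P z ^ m := by simp [evalPoly]

lemma evalPoly_one : evalPoly (1 : MvPolynomial (Fin n) ℂ) z = 1 := by simp [evalPoly]

lemma evalPoly_C (a : ℂ) : evalPoly (MvPolynomial.C a) z = a := by simp [evalPoly]

lemma continuous_evalPoly : Continuous (evalPoly P) :=
  (MvPolynomial.continuous_eval P).comp (by fun_prop)

end EvalPoly

section Separation

variable {n : ℕ} {K X Y : Set (EuclideanSpace ℂ (Fin n))}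

lemma norm_evalPoly_le_iSup (hK : IsCompact K) (P : MvPolynomial (Fin n) ℂ)
    {z : EuclideanSpace ℂ (Fin n)} (hz : z ∈ K) :
    ‖evalPoly P z‖ ≤ ⨆ w ∈ K, ‖evalPoly P w‖ := by
  obtain ⟨M, hM⟩ := hK.exists_bound_of_continuousOn (continuous_evalPoly P).continuousOn
  have hbdd : BddAbove (Set.range fun w => ⨆ _ : w ∈ K, ‖evalPoly P w‖) := by
    refine ⟨max M 0, ?_⟩
    rintro _ ⟨w, rfl⟩
    exact Real.iSup_le (fun hw => (hM w hw).trans (le_max_left _ _)) (le_max_right _ _)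
  refine le_trans ?_ (le_ciSup hbdd z)
  simp [hz]

/-- A compact set is polynomially convex as soon as polynomials separate it from each point of
its complement. -/
lemma isPolyConvex_of_separated (hK : IsCompact K)
    (h : ∀ z ∉ K, ∃ (P : MvPolynomial (Fin n) ℂ) (c : ℝ), 0 ≤ c ∧
      (∀ w ∈ K, ‖evalPoly P w‖ ≤ c) ∧ c < ‖evalPoly P z‖) : IsPolyConvex K := by
  refine Set.Subset.antisymm (fun z hz => ?_) fun z hz P => norm_evalPoly_le_iSup hK P hz
  by_contra hzK
  obtain ⟨P, c, hc, hPK, hPz⟩ := h z hzK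
  have hsup : ⨆ w ∈ K, ‖evalPoly P w‖ ≤ c :=
    Real.iSup_le (fun w => Real.iSup_le (hPK w) hc) hc
  exact absurd ((hz P).trans hsup) (not_le.mpr hPz)

/-- A point outside a compact polynomially convex set `K` is a peak of polynomials that are
arbitrarily small on `K`. -/
lemma IsPolyConvex.exists_eval_eq_one (hK : IsCompact K) (hKpc : IsPolyConvex K)
    {z : EuclideanSpace ℂ (Fin n)} (hz : z ∉ K) {ε : ℝ} (hε : 0 < ε) :
    ∃ P : MvPolynomial (Fin n) ℂ, evalPoly P z = 1 ∧ ∀ w ∈ K, ‖evalPoly P w‖ ≤ ε := by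
  have hz' : z ∉ polyHull K := by rwa [show polyHull K = K from hKpc]
  obtain ⟨P, hP⟩ : ∃ P : MvPolynomial (Fin n) ℂ,
      ⨆ w ∈ K, ‖evalPoly P w‖ < ‖evalPoly P z‖ := by
    simpa [polyHull] using hz'
  set c := ⨆ w ∈ K, ‖evalPoly P w‖ with hc
  have hc0 : 0 ≤ c := Real.iSup_nonneg fun w => Real.iSup_nonneg fun _ => norm_nonneg _
  have hpos : 0 < ‖evalPoly P z‖ := hc0.trans_lt hP
  obtain ⟨m, hm⟩ := exists_pow_lt_of_lt_one hε ((div_lt_one hpos).mpr hP)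
  refine ⟨(MvPolynomial.C (evalPoly P z)⁻¹ * P) ^ m, ?_, fun w hw => ?_⟩
  · rw [evalPoly_pow, evalPoly_mul, evalPoly_C, inv_mul_cancel₀ (norm_pos_iff.mp hpos), one_pow]
  · rw [evalPoly_pow, evalPoly_mul, evalPoly_C, norm_pow, norm_mul, norm_inv, inv_mul_eq_div]
    refine le_trans ?_ hm.le
    gcongr
    exact norm_evalPoly_le_iSup hK P hw

lemma norm_smoothstep_le {t : ℂ} {δ : ℝ} (ht : ‖t‖ ≤ δ) (hδ : δ ≤ 1 / 10) :
    ‖3 * t ^ 2 - 2 * t ^ 3‖ ≤ δ / 2 := by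
  have h0 := norm_nonneg t
  calc ‖3 * t ^ 2 - 2 * t ^ 3‖ ≤ ‖3 * t ^ 2‖ + ‖2 * t ^ 3‖ := norm_sub_le _ _
    _ = 3 * ‖t‖ ^ 2 + 2 * ‖t‖ ^ 3 := by simp
    _ ≤ 3 * δ ^ 2 + 2 * δ ^ 3 := by gcongr
    _ ≤ δ / 2 := by
      have : 0 ≤ δ := h0.trans ht
      nlinarith [mul_nonneg this (sub_nonneg.mpr hδ), mul_nonneg this this,
        mul_nonneg (mul_nonneg this this) (sub_nonneg.mpr hδ)]

/-- Iterating `t ↦ 3 t² - 2 t³` sharpens a polynomial whose values are near `0` or near `1`. -/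
lemma exists_sharpened (P : MvPolynomial (Fin n) ℂ) (m : ℕ) :
    ∃ Q : MvPolynomial (Fin n) ℂ, ∀ z,
      (‖evalPoly P z‖ ≤ 1 / 10 → ‖evalPoly Q z‖ ≤ 1 / 10 * (1 / 2) ^ m) ∧
      (‖1 - evalPoly P z‖ ≤ 1 / 10 → ‖1 - evalPoly Q z‖ ≤ 1 / 10 * (1 / 2) ^ m) := by
  induction m with
  | zero => exact ⟨P, fun z => by simp⟩
  | succ m ih =>
    obtain ⟨Q, hQ⟩ := ih
    have hδ : (1 / 10 * (1 / 2) ^ m : ℝ) ≤ 1 / 10 :=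
      mul_le_of_le_one_right (by norm_num) (pow_le_one₀ (by norm_num) (by norm_num))
    have hpow : (1 / 10 * (1 / 2) ^ (m + 1) : ℝ) = 1 / 10 * (1 / 2) ^ m / 2 := by ring
    refine ⟨MvPolynomial.C 3 * Q ^ 2 - MvPolynomial.C 2 * Q ^ 3, fun z => ?_⟩
    simp only [evalPoly_sub, evalPoly_mul, evalPoly_pow, evalPoly_C]
    rw [hpow]
    refine ⟨fun h => norm_smoothstep_le ((hQ z).1 h) hδ, fun h => ?_⟩
    convert norm_smoothstep_le ((hQ z).2 h) hδ using 2
    ring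

/-- A polynomial `P` near `0` on `X` and near `1` on `Y` lets one separate from `X ∪ Y` the points
outside `X` at which `P` is near `0`. -/
lemma exists_separating_union (hX : IsCompact X) (hXpc : IsPolyConvex X) (hY : IsCompact Y)
    {P : MvPolynomial (Fin n) ℂ} (hPX : ∀ w ∈ X, ‖evalPoly P w‖ ≤ 1 / 10)
    (hPY : ∀ w ∈ Y, ‖1 - evalPoly P w‖ ≤ 1 / 10) {z : EuclideanSpace ℂ (Fin n)} (hz : z ∉ X)
    (hPz : ‖evalPoly P z‖ ≤ 1 / 10) :
    ∃ (R : MvPolynomial (Fin n) ℂ) (c : ℝ), 0 ≤ c ∧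
      (∀ w ∈ X ∪ Y, ‖evalPoly R w‖ ≤ c) ∧ c < ‖evalPoly R z‖ := by
  obtain ⟨R, hRz, hRX⟩ := hXpc.exists_eval_eq_one hX hz (ε := 1 / 4) (by norm_num)
  obtain ⟨M, hM⟩ := hY.exists_bound_of_continuousOn (continuous_evalPoly R).continuousOn
  obtain ⟨m, hm⟩ := exists_pow_lt_of_lt_one (show 0 < 1 / (|M| + 1) by positivity)
    (show (1 / 2 : ℝ) < 1 by norm_num)
  obtain ⟨Q, hQ⟩ := exists_sharpened P m
  have hδ : (1 / 10 * (1 / 2) ^ m : ℝ) ≤ 1 / 10 :=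
    mul_le_of_le_one_right (by norm_num) (pow_le_one₀ (by norm_num) (by norm_num))
  refine ⟨R * (1 - Q), 1 / 2, by norm_num, ?_, ?_⟩
  · rintro w (hw | hw)
    · have hQw := ((hQ w).1 (hPX w hw)).trans hδ
      rw [evalPoly_mul, evalPoly_sub, evalPoly_one, norm_mul]
      have h1 : ‖1 - evalPoly Q w‖ ≤ 1 + 1 / 10 :=
        (norm_sub_le _ _).trans (by rw [norm_one]; gcongr)
      calc ‖evalPoly R w‖ * ‖1 - evalPoly Q w‖ ≤ 1 / 4 * (1 + 1 / 10) := by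
            gcongr
            exact hRX w hw
        _ ≤ 1 / 2 := by norm_num
    · have hQw := (hQ w).2 (hPY w hw)
      rw [evalPoly_mul, evalPoly_sub, evalPoly_one, norm_mul]
      calc ‖evalPoly R w‖ * ‖1 - evalPoly Q w‖
          ≤ (|M| + 1) * (1 / 10 * (1 / (|M| + 1))) := by
            gcongr
            · linarith [hM w hw, le_abs_self M]
            · exact hQw.trans (by gcongr)
        _ ≤ 1 / 2 := by
            have : |M| + 1 ≠ 0 := by positivity
            field_simp
            norm_num
  · have hQz := ((hQ z).1 hPz).trans hδ
    rw [evalPoly_mul, evalPoly_sub, evalPoly_one, hRz, one_mul]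
    have := norm_sub_norm_le 1 (evalPoly Q z)
    rw [norm_one] at this
    linarith

/-- A form of Kallin's lemma: the union of two compact polynomially convex sets is polynomially
convex if some polynomial is near `0` on the first and near `1` on the second. -/
lemma IsPolyConvex.union (hX : IsCompact X) (hXpc : IsPolyConvex X) (hY : IsCompact Y)
    (hYpc : IsPolyConvex Y) {P : MvPolynomial (Fin n) ℂ}
    (hPX : ∀ w ∈ X, ‖evalPoly P w‖ ≤ 1 / 40) (hPY : ∀ w ∈ Y, ‖1 - evalPoly P w‖ ≤ 1 / 40) :
    IsPolyConvex (X ∪ Y) := by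
  refine isPolyConvex_of_separated (hX.union hY) fun z hz => ?_
  obtain ⟨hzX, hzY⟩ := not_or.mp hz
  have hweak : (1 / 40 : ℝ) ≤ 1 / 10 := by norm_num
  by_cases h0 : ‖evalPoly P z‖ ≤ 1 / 10
  · exact exists_separating_union hX hXpc hY (fun w hw => (hPX w hw).trans hweak)
      (fun w hw => (hPY w hw).trans hweak) hzX h0
  by_cases h1 : ‖1 - evalPoly P z‖ ≤ 1 / 10
  · rw [Set.union_comm]
    refine exists_separating_union (P := 1 - P) hY hYpc hX (fun w hw => ?_) (fun w hw => ?_) hzY ?_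
    · rw [evalPoly_sub, evalPoly_one]
      exact (hPY w hw).trans hweak
    · rw [evalPoly_sub, evalPoly_one, sub_sub_cancel]
      exact (hPX w hw).trans hweak
    · rwa [evalPoly_sub, evalPoly_one]
  refine ⟨P * (1 - P), 1 / 40 * (1 + 1 / 40), by norm_num, ?_, ?_⟩
  · rintro w (hw | hw) <;> rw [evalPoly_mul, evalPoly_sub, evalPoly_one, norm_mul]
    · have hPw := hPX w hw
      have : ‖1 - evalPoly P w‖ ≤ 1 + 1 / 40 :=
        (norm_sub_le _ _).trans (by rw [norm_one]; gcongr)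
      gcongr
    · have hPw := hPY w hw
      have : ‖evalPoly P w‖ ≤ 1 + 1 / 40 := by
        have h := norm_sub_le 1 (1 - evalPoly P w)
        rw [sub_sub_cancel, norm_one] at h
        linarith
      rw [mul_comm]
      gcongr
  · rw [evalPoly_mul, evalPoly_sub, evalPoly_one, norm_mul]
    push Not at h0 h1
    have h := norm_add_le (evalPoly P z) (1 - evalPoly P z)
    rw [add_sub_cancel, norm_one] at h
    nlinarith [mul_pos (sub_pos.mpr h0) (sub_pos.mpr h1)]

lemma isPolyConvex_closedBall (p : EuclideanSpace ℂ (Fin n)) (r : ℝ) :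
    IsPolyConvex (Metric.closedBall p r) := by
  refine isPolyConvex_of_separated (isCompact_closedBall p r) fun z hz => ?_
  rcases lt_or_ge r 0 with hr | hr
  · refine ⟨1, 0, le_rfl, fun w hw => ?_, by simp [evalPoly_one]⟩
    simp [Metric.closedBall_eq_empty.mpr hr] at hw
  have hP (w : EuclideanSpace ℂ (Fin n)) :
      evalPoly (∑ i, MvPolynomial.C (conj ((z - p) i)) *
        (MvPolynomial.X i - MvPolynomial.C (p i))) w = inner ℂ (z - p) (w - p) := by
    rw [PiLp.inner_apply]
    simp [evalPoly, mul_comm]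
  have hrz : r < ‖z - p‖ := by simpa [dist_eq_norm] using hz
  refine ⟨∑ i, MvPolynomial.C (conj ((z - p) i)) * (MvPolynomial.X i - MvPolynomial.C (p i)),
    ‖z - p‖ * r, by positivity, fun w hw => ?_, ?_⟩
  · rw [hP]
    refine (norm_inner_le_norm _ _).trans ?_
    gcongr
    simpa [dist_eq_norm] using hw
  · rw [hP, inner_self_eq_norm_sq_to_K, norm_pow, RCLike.norm_ofReal, abs_norm, sq]
    gcongr
    exact hr.trans_lt hrz

lemma exists_radius_isPolyConvex_union (hK : IsCompact K) (hKpc : IsPolyConvex K)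
    (S : Finset (EuclideanSpace ℂ (Fin n))) (hS : ∀ x ∈ S, x ∉ K) :
    ∃ r : ℝ, 0 < r ∧ ∀ r' : EuclideanSpace ℂ (Fin n) → ℝ, (∀ x ∈ S, r' x ≤ r) →
      IsPolyConvex (K ∪ ⋃ x ∈ S, Metric.closedBall x (r' x)) := by
  induction S using Finset.induction_on with
  | empty => exact ⟨1, one_pos, fun _ _ => by simpa using hKpc⟩
  | insert p S hpS ih =>
    obtain ⟨r, hr, hpc⟩ := ih fun x hx => hS x (Finset.mem_insert_of_mem hx)
    have hcompact (ρ : EuclideanSpace ℂ (Fin n) → ℝ) :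
        IsCompact (K ∪ ⋃ x ∈ S, Metric.closedBall x (ρ x)) :=
      hK.union (S.isCompact_biUnion fun x _ => isCompact_closedBall x _)
    obtain ⟨δ, hδ, hball⟩ := Metric.isOpen_iff.mp S.finite_toSet.isClosed.isOpen_compl p
      (by simpa using hpS)
    set s := min r (δ / 2)
    have hpL : p ∉ K ∪ ⋃ x ∈ S, Metric.closedBall x s := by
      rintro (hp | hp)
      · exact hS p (Finset.mem_insert_self _ _) hp
      · obtain ⟨x, hx, hpx⟩ := Set.mem_iUnion₂.mp hp
        refine hball (a := x) ?_ hx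
        rw [Metric.mem_ball, dist_comm]
        linarith [Metric.mem_closedBall.mp hpx, min_le_right r (δ / 2)]
    obtain ⟨P, hPp, hPL⟩ := (hpc (fun _ => s) fun _ _ => min_le_left _ _).exists_eval_eq_one
      (hcompact _) hpL (ε := 1 / 40) (by norm_num)
    obtain ⟨η, hη, hPη⟩ := Metric.continuousAt_iff.mp
      ((continuous_evalPoly P).continuousAt (x := p)) (1 / 40) (by norm_num)
    refine ⟨min s (η / 2), by positivity, fun r' hr' => ?_⟩
    have hr's : ∀ x ∈ S, r' x ≤ s := fun x hx =>
      (hr' x (Finset.mem_insert_of_mem hx)).trans (min_le_left _ _)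
    have hunion : K ∪ ⋃ x ∈ insert p S, Metric.closedBall x (r' x) =
        (K ∪ ⋃ x ∈ S, Metric.closedBall x (r' x)) ∪ Metric.closedBall p (r' p) := by
      rw [Finset.set_biUnion_insert, Set.union_comm (Metric.closedBall _ _), Set.union_assoc]
    rw [hunion]
    refine (hpc r' fun x hx => (hr's x hx).trans (min_le_left _ _)).union (P := P) (hcompact r')
      (isCompact_closedBall _ _) (isPolyConvex_closedBall _ _) (fun w hw => hPL w ?_)
      fun w hw => ?_
    · exact Set.union_subset_union_right K
        (Set.iUnion₂_mono fun x hx => Metric.closedBall_subset_closedBall (hr's x hx)) hw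
    · have hwη : dist w p < η := by
        linarith [Metric.mem_closedBall.mp hw, hr' p (Finset.mem_insert_self _ _),
          min_le_right s (η / 2)]
      have := hPη hwη
      rw [hPp, dist_comm, dist_eq_norm] at this
      exact this.le

end Separation

/-- **Lemma 2.1.** If `K ⊆ ℂ^n` is compact and polynomially convex and
`p₁, …, p_ℓ ∈ ℂ^n \ K`, then there are radii `r₁, …, r_ℓ > 0` such that for all
`0 < r'_j ≤ r_j` the union of `K` with the closed balls `B̄_{p_j}(r'_j)` is
polynomially convex. -/
theorem polyConvex_union_closedBalls
    (n ℓ : ℕ) (K : Set (EuclideanSpace ℂ (Fin n)))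
    (hK : IsCompact K) (hKpc : IsPolyConvex K)
    (p : Fin ℓ → EuclideanSpace ℂ (Fin n)) (hp : ∀ j, p j ∉ K) :
    ∃ r : Fin ℓ → ℝ, (∀ j, 0 < r j) ∧
      ∀ r' : Fin ℓ → ℝ, (∀ j, 0 < r' j) → (∀ j, r' j ≤ r j) →
        IsPolyConvex (K ∪ ⋃ j, Metric.closedBall (p j) (r' j)) := by
  classical
  obtain ⟨r, hr, hpc⟩ := exists_radius_isPolyConvex_union hK hKpc (Finset.univ.image p)
    (by simpa using hp)
  refine ⟨fun _ => r, fun _ => hr, fun r' _ hr' => ?_⟩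
  -- Coinciding centres are merged: `ρ x` is the radius of the largest ball centred at `x`.
  have hmax (x) (hx : x ∈ Finset.univ.image p) :
      ∃ ρ, (∃ i, p i = x ∧ r' i = ρ) ∧ ∀ j, p j = x → r' j ≤ ρ := by
    obtain ⟨j, -, rfl⟩ := Finset.mem_image.mp hx
    obtain ⟨i, hi, hmax⟩ := (Finset.univ.filter fun i => p i = p j).exists_max_image r'
      ⟨j, by simp⟩
    exact ⟨r' i, ⟨i, by simpa using hi, rfl⟩, fun k hk => hmax k (by simpa using hk)⟩
  choose! ρ hρ hle using hmax
  have hunion : ⋃ j, Metric.closedBall (p j) (r' j) =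
      ⋃ x ∈ Finset.univ.image p, Metric.closedBall x (ρ x) := by
    refine Set.Subset.antisymm (Set.iUnion_subset fun j => ?_) (Set.iUnion₂_subset fun x hx => ?_)
    · have hj : p j ∈ Finset.univ.image p := Finset.mem_image_of_mem p (Finset.mem_univ j)
      exact (Metric.closedBall_subset_closedBall (hle _ hj j rfl)).trans
        (Set.subset_biUnion_of_mem (u := fun x => Metric.closedBall x (ρ x)) hj)
    · obtain ⟨i, hi, hri⟩ := hρ x hx
      rw [← hri, ← hi]
      exact Set.subset_iUnion (fun j => Metric.closedBall (p j) (r' j)) i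
  rw [hunion]
  refine hpc ρ fun x hx => ?_
  obtain ⟨i, -, hri⟩ := hρ x hx
  exact hri ▸ hr' i
end
end
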